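/- Let K be a difference subfield of U with σ(K) = K, let a be a finite tuple with σ(a) ∈ K(a)^alg, and let d be a finite tuple with σ(d) ∈ K(d)^alg which is equi-algebraic with a over K, i.e. K(d)^alg = K(a)^alg. Then the following are equivalent: (i) ld(d/K) = dd(a/K); (ii) ld(d/K) ≤ ld(e/K) for every finite tuple e with K(e)^alg = K(a)^alg. Moreover, these conditions hold if and only if the analogous condition for σ^{-1} holds, i.e. if and only if ild(d/K) = idd(a/K). -/

import Mathlib

/- Setting: a large algebraically closed field `U` with an automorphism `σ`.
   Tuples are maps `Fin n → U`; for a tuple `t`, the relevant set of coordinates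
   is `Set.range t`.  `fAdj E s` is the subfield `E(s)` generated by a subfield
   `E` and a set `s`, and `deg E s` is the degree `μ(s/E) = [E(s):E]`. -/

set_option maxHeartbeats 1000000
set_option synthInstance.maxHeartbeats 1000000

open Filter Set

variable {U : Type*}

/-- The subfield `E(s)` generated by the subfield `E` and the set `s`. -/
noncomputable def fAdj [Field U] (E : Subfield U) (s : Set U) : Subfield U :=
  (IntermediateField.adjoin E s).toSubfield

/-- The degree `μ(s/E) = [E(s):E]` (as `Module.finrank`; it is `0` when infinite). -/
noncomputable def deg [Field U] (E : Subfield U) (s : Set U) : ℕ :=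
  Module.finrank E (IntermediateField.adjoin E s)

/-- `k ↦ μ(σ^{k+1}(s) / K(s, σ(s), …, σ^k(s)))`: the sequence whose eventual
value is the limit degree `ld(s/K)`. -/
noncomputable def ldSeq [Field U] (σ : U ≃+* U) (K : Subfield U) (s : Set U) (k : ℕ) : ℕ :=
  deg (fAdj K (⋃ i ∈ Set.Iic k, ⇑(σ ^ i) '' s)) (⇑(σ ^ (k + 1)) '' s)

/-- `k ↦ μ(σ^k(s) / K(s))`: the sequence whose `k`-th roots converge to the
distant degree `dd(s/K)`. -/
noncomputable def ddSeq [Field U] (σ : U ≃+* U) (K : Subfield U) (s : Set U) (k : ℕ) : ℕ :=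
  deg (fAdj K s) (⇑(σ ^ k) '' s)

/-- The inversive closure `K^inv = ⋃ₙ σ^{-n}(K)`. -/
noncomputable def Kinv [Field U] (σ : U ≃+* U) (K : Subfield U) : Subfield U :=
  ⨆ n : ℕ, K.map (σ⁻¹ ^ n : U ≃+* U).toRingHom

/-- The difference field `K(s)_σ = K(σ^i(s) : i ∈ ℕ)` generated by `s` over `K`. -/
noncomputable def diffAdj [Field U] (σ : U ≃+* U) (K : Subfield U) (s : Set U) : Subfield U :=
  fAdj K (⋃ i : ℕ, ⇑(σ ^ i) '' s)

section SupDegree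

variable [Field U]

/-- The degree `[A ⊔ B : A]` of a compositum over one of its factors (`0` when infinite). -/
noncomputable def supDegree (A B : Subfield U) : ℕ := A.relfinrank (A ⊔ B)

theorem relfinrank_sup_le {A B : Subfield U} (hAB : A ≤ B) (C : Subfield U)
    (h : A.relfinrank B ≠ 0) :
    (A ⊔ C).relfinrank (B ⊔ C) ≠ 0 ∧ (A ⊔ C).relfinrank (B ⊔ C) ≤ A.relfinrank B := by
  let D : Subfield U := A ⊔ C
  have hAD : A ≤ D := le_sup_left
  let : Algebra A D := (Subfield.inclusion hAD).toAlgebra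
  have : IsScalarTower A D U := IsScalarTower.of_algebraMap_eq fun _ => rfl
  let L : IntermediateField A U := Subfield.extendScalars hAB
  have hL : A.relfinrank B = Module.finrank A L := Subfield.relfinrank_eq_finrank_of_le hAB
  have : FiniteDimensional A L := Module.finite_of_finrank_pos (by omega)
  have hrk := IntermediateField.adjoin_rank_le_of_isAlgebraic_right D L
  have hDB : D ≤ B ⊔ C := sup_le_sup_right hAB C
  have hM : IntermediateField.adjoin D (L : Set U) = Subfield.extendScalars hDB := by
    apply le_antisymm
    · rw [IntermediateField.adjoin_le_iff]
      intro x hx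
      exact (le_sup_left : B ≤ B ⊔ C) hx
    · intro x hx
      have : B ⊔ C ≤ (IntermediateField.adjoin D (L : Set U)).toSubfield := by
        apply sup_le
        · intro y hy
          exact IntermediateField.subset_adjoin D _ hy
        · intro y hy
          exact (IntermediateField.adjoin D (L : Set U)).algebraMap_mem
            ⟨y, (le_sup_right : C ≤ D) hy⟩
      exact this hx
  rw [hM] at hrk
  have hfin : Module.rank A L < Cardinal.aleph0 := Module.rank_lt_aleph0 A L
  have : FiniteDimensional D (Subfield.extendScalars hDB) :=
    Module.rank_lt_aleph0_iff.mp (hrk.trans_lt hfin)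
  have hD : D.relfinrank (B ⊔ C) = Module.finrank D (Subfield.extendScalars hDB) :=
    Subfield.relfinrank_eq_finrank_of_le hDB
  refine ⟨?_, ?_⟩
  · change D.relfinrank (B ⊔ C) ≠ 0
    rw [hD]
    exact Module.finrank_pos.ne'
  · change D.relfinrank (B ⊔ C) ≤ _
    rw [hD, hL]
    exact Cardinal.toNat_le_toNat hrk hfin

theorem supDegree_mul (A B C : Subfield U) :
    supDegree A B * supDegree (A ⊔ B) C = supDegree A (B ⊔ C) := by
  simp only [supDegree, sup_assoc]
  exact Subfield.relfinrank_mul_relfinrank le_sup_left (sup_le_sup_left le_sup_left A)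

theorem supDegree_eq_one_iff {A B : Subfield U} : supDegree A B = 1 ↔ B ≤ A := by
  simp [supDegree, Subfield.relfinrank_eq_one_iff]

theorem supDegree_congr {A B B' : Subfield U} (h : A ⊔ B = A ⊔ B') :
    supDegree A B = supDegree A B' := by
  simp [supDegree, h]

theorem supDegree_map (f : U →+* U) (A B : Subfield U) :
    supDegree (A.map f) (B.map f) = supDegree A B := by
  rw [supDegree, ← Subfield.map_sup, Subfield.relfinrank_map_map, supDegree]

theorem supDegree_anti_left {A A' B : Subfield U} (hA : A ≤ A') (h : supDegree A B ≠ 0) :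
    supDegree A' B ≠ 0 ∧ supDegree A' B ≤ supDegree A B := by
  have := relfinrank_sup_le (le_sup_left : A ≤ A ⊔ B) A' h
  rwa [sup_eq_right.mpr hA, sup_right_comm, sup_eq_right.mpr hA] at this

theorem supDegree_dvd {A B B' : Subfield U} (hB : B ≤ A ⊔ B') :
    supDegree A B ∣ supDegree A B' := by
  have := supDegree_mul A B B'
  rw [supDegree_congr (B' := B') (B := B ⊔ B')] at this
  · exact ⟨_, this.symm⟩
  · rw [← sup_assoc, sup_right_comm, sup_eq_left.mpr hB]

theorem supDegree_ne_zero_mono {A A' B B' : Subfield U} (hA : A ≤ A') (hB : B' ≤ B)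
    (h : supDegree A B ≠ 0) : supDegree A' B' ≠ 0 :=
  ne_zero_of_dvd_ne_zero (supDegree_anti_left hA h).1 (supDegree_dvd (hB.trans le_sup_right))

theorem supDegree_sup_ne_zero {A B C : Subfield U} (hB : supDegree A B ≠ 0)
    (hC : supDegree A C ≠ 0) : supDegree A (B ⊔ C) ≠ 0 := by
  rw [← supDegree_mul]
  exact mul_ne_zero hB (supDegree_anti_left le_sup_left hC).1

theorem supDegree_ne_zero_trans {A B C : Subfield U} (hB : supDegree A B ≠ 0)
    (hC : supDegree B C ≠ 0) : supDegree A C ≠ 0 := by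
  have h : supDegree A (B ⊔ C) ≠ 0 := by
    rw [← supDegree_mul]
    exact mul_ne_zero hB (supDegree_anti_left le_sup_right hC).1
  exact supDegree_ne_zero_mono le_rfl le_sup_right h

theorem supDegree_le_of_le {A B B' : Subfield U} (hB : B ≤ A ⊔ B') (h : supDegree A B' ≠ 0) :
    supDegree A B ≤ supDegree A B' :=
  Nat.le_of_dvd (Nat.pos_of_ne_zero h) (supDegree_dvd hB)

/-- If `B` and `C` are linearly disjoint over `A`, then passing from a field between `A` and `B`
to its compositum with a subfield of `C` preserves degrees of subfields of `B`. -/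
theorem supDegree_sup_eq_of_disjoint {A B C A' B' C' : Subfield U} (hAC : A ≤ C)
    (h0 : supDegree A B ≠ 0) (h : supDegree C B = supDegree A B)
    (hAA' : A ≤ A') (hA' : A' ≤ B) (hB' : B' ≤ B) (hC' : C' ≤ C) :
    supDegree (A' ⊔ C') B' = supDegree A' B' := by
  have e1 : supDegree A A' * (supDegree A' B' * supDegree (A' ⊔ B') B) = supDegree A B := by
    have hl := supDegree_mul A A' (B' ⊔ B)
    rw [sup_eq_right.mpr hAA', sup_eq_right.mpr hB', sup_eq_right.mpr hA'] at hl
    rw [supDegree_mul, sup_eq_right.mpr hB', hl]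
  have e2 : supDegree C A' * (supDegree (C ⊔ A') B' * supDegree (C ⊔ A' ⊔ B') B) =
      supDegree C B := by
    rw [supDegree_mul, supDegree_mul, sup_eq_right.mpr hB', sup_eq_right.mpr hA']
  rw [← h, ← e2] at e1
  have hA0 : supDegree A A' ≠ 0 := supDegree_ne_zero_mono le_rfl hA' h0
  have hB0 : supDegree A' B' ≠ 0 := supDegree_ne_zero_mono hAA' hB' h0
  have hC0 : supDegree (A' ⊔ B') B ≠ 0 :=
    supDegree_ne_zero_mono (hAA'.trans le_sup_left) le_rfl h0
  have i1 := supDegree_anti_left hAC hA0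
  have i2 := supDegree_anti_left (le_sup_left : A' ≤ A' ⊔ C') hB0
  have i3 := supDegree_anti_left (sup_le le_sup_right (hC'.trans le_sup_left) :
    A' ⊔ C' ≤ C ⊔ A') i2.1
  have i4 := supDegree_anti_left (sup_le_sup_right le_sup_right B' :
    A' ⊔ B' ≤ C ⊔ A' ⊔ B') hC0
  refine le_antisymm i2.2 (le_trans ?_ i3.2)
  by_contra! hlt
  have : supDegree C A' * (supDegree (C ⊔ A') B' * supDegree (C ⊔ A' ⊔ B') B) <
      supDegree A A' * (supDegree A' B' * supDegree (A' ⊔ B') B) := by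
    apply Nat.mul_lt_mul_of_le_of_lt i1.2 _ (Nat.pos_of_ne_zero hA0)
    exact Nat.mul_lt_mul_of_lt_of_le hlt i4.2 (Nat.pos_of_ne_zero hC0)
  omega

theorem supDegree_eq_of_disjoint_symm {A B C : Subfield U} (hAB : A ≤ B) (hAC : A ≤ C)
    (h0 : supDegree A B ≠ 0) (h : supDegree C B = supDegree A B) :
    supDegree B C = supDegree A C := by
  have e1 := supDegree_mul A B C
  have e2 := supDegree_mul A C B
  rw [sup_eq_right.mpr hAB] at e1
  rw [sup_eq_right.mpr hAC, sup_comm, h, mul_comm, ← e1] at e2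
  exact (Nat.eq_of_mul_eq_mul_left (Nat.pos_of_ne_zero h0) e2).symm

end SupDegree

section Window

variable [Field U]

/-- The conjugate `σ^i(E)` of a subfield. -/
noncomputable def conjField (σ : U ≃+* U) (E : Subfield U) (i : ℤ) : Subfield U :=
  E.map (σ ^ i : U ≃+* U).toRingHom

/-- The compositum of the conjugates `σ^i(E)` for `m ≤ i ≤ n`. -/
noncomputable def window (σ : U ≃+* U) (E : Subfield U) (m n : ℤ) : Subfield U :=
  ⨆ i ∈ Set.Icc m n, conjField σ E i

variable (σ : U ≃+* U) (E : Subfield U)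

theorem conjField_zero : conjField σ E 0 = E := by
  ext x
  simp [conjField, Subfield.mem_map]

theorem conjField_map (i k : ℤ) :
    (conjField σ E i).map (σ ^ k : U ≃+* U).toRingHom = conjField σ E (i + k) := by
  ext x
  simp [conjField, Subfield.mem_map, add_comm i k, zpow_add]

theorem conjField_conjField (i k : ℤ) :
    conjField σ (conjField σ E i) k = conjField σ E (i + k) :=
  conjField_map σ E i k

theorem conjField_mono {E F : Subfield U} (h : E ≤ F) (i : ℤ) :
    conjField σ E i ≤ conjField σ F i := by
  rintro _ ⟨x, hx, rfl⟩
  exact ⟨x, h hx, rfl⟩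

theorem conjField_sup (A B : Subfield U) (i : ℤ) :
    conjField σ (A ⊔ B) i = conjField σ A i ⊔ conjField σ B i :=
  Subfield.map_sup _ _ _

theorem conjField_le_window {i m n : ℤ} (hm : m ≤ i) (hn : i ≤ n) :
    conjField σ E i ≤ window σ E m n :=
  le_iSup₂_of_le i ⟨hm, hn⟩ le_rfl

theorem window_le_iff {m n : ℤ} {F : Subfield U} :
    window σ E m n ≤ F ↔ ∀ i, m ≤ i → i ≤ n → conjField σ E i ≤ F := by
  simp [window, iSup_le_iff]

theorem window_mono {m n m' n' : ℤ} (hm : m' ≤ m) (hn : n ≤ n') :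
    window σ E m n ≤ window σ E m' n' :=
  (window_le_iff σ E).2 fun _ h h' => conjField_le_window σ E (hm.trans h) (h'.trans hn)

theorem window_self (m : ℤ) : window σ E m m = conjField σ E m := by
  apply le_antisymm
  · rw [window_le_iff]
    intro i h h'
    rw [le_antisymm h' h]
  · exact conjField_le_window σ E le_rfl le_rfl

theorem window_sup_window {m n p q : ℤ} (hmp : m ≤ p) (hpn : p ≤ n + 1) (hnq : n ≤ q) :
    window σ E m n ⊔ window σ E p q = window σ E m q := by
  apply le_antisymm
  · exact sup_le (window_mono σ E le_rfl hnq) (window_mono σ E hmp le_rfl)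
  · rw [window_le_iff]
    intro i h h'
    rcases le_or_gt i n with hi | hi
    · exact (conjField_le_window σ E h hi).trans le_sup_left
    · exact (conjField_le_window σ E (by omega) h').trans le_sup_right

theorem window_map (m n k : ℤ) :
    (window σ E m n).map (σ ^ k : U ≃+* U).toRingHom = window σ E (m + k) (n + k) := by
  rw [window, Subfield.map_iSup]
  simp_rw [Subfield.map_iSup, conjField_map]
  apply le_antisymm
  · exact iSup₂_le fun i hi => conjField_le_window σ E (by linarith [hi.1]) (by linarith [hi.2])
  · rw [window_le_iff]
    intro i h h'
    exact le_iSup₂_of_le (i - k) ⟨by linarith, by linarith⟩ (by simp)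

theorem conjField_window (m n k : ℤ) :
    conjField σ (window σ E m n) k = window σ E (m + k) (n + k) :=
  window_map σ E m n k

theorem supDegree_conjField (A B : Subfield U) (k : ℤ) :
    supDegree (conjField σ A k) (conjField σ B k) = supDegree A B :=
  supDegree_map _ A B

theorem window_window (p q : ℤ) (m n : ℤ) (hpq : p ≤ q) (hmn : m ≤ n) :
    window σ (window σ E p q) m n = window σ E (p + m) (q + n) := by
  apply le_antisymm
  · rw [window_le_iff]
    intro i h h'
    rw [conjField_window]
    exact window_mono σ E (by omega) (by omega)
  · rw [window_le_iff]
    intro i h h'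
    have : ∃ j, m ≤ j ∧ j ≤ n ∧ p + j ≤ i ∧ i ≤ q + j := by
      by_cases hc : i - p ≤ n
      · exact ⟨max m (i - q), by omega, by omega, by omega, by omega⟩
      · exact ⟨n, by omega, by omega, by omega, by omega⟩
    obtain ⟨j, h1, h2, h3, h4⟩ := this
    refine le_trans ?_ (conjField_le_window σ _ h1 h2)
    rw [conjField_window]
    exact conjField_le_window σ E h3 h4

variable {σ E}

theorem supDegree_conjField_ne_zero (h1 : supDegree E (conjField σ E 1) ≠ 0)
    (h2 : supDegree (conjField σ E 1) E ≠ 0) (i j : ℤ) :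
    supDegree (conjField σ E i) (conjField σ E j) ≠ 0 := by
  have up (i : ℤ) : supDegree (conjField σ E i) (conjField σ E (i + 1)) ≠ 0 := by
    rwa [add_comm, ← conjField_conjField, supDegree_conjField]
  have down (i : ℤ) : supDegree (conjField σ E (i + 1)) (conjField σ E i) ≠ 0 := by
    rwa [add_comm, ← conjField_conjField, supDegree_conjField]
  have self (i : ℤ) : supDegree (conjField σ E i) (conjField σ E i) ≠ 0 := by
    rw [supDegree_eq_one_iff.2 le_rfl]
    exact one_ne_zero
  have key (n : ℕ) (i : ℤ) : supDegree (conjField σ E i) (conjField σ E (i + n)) ≠ 0 ∧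
      supDegree (conjField σ E (i + n)) (conjField σ E i) ≠ 0 := by
    induction n with
    | zero => simpa using self i
    | succ n ih =>
      push_cast
      rw [← add_assoc]
      exact ⟨supDegree_ne_zero_trans ih.1 (up _), supDegree_ne_zero_trans (down _) ih.2⟩
  rcases le_total i j with h | h
  · simpa [h] using (key (j - i).toNat i).1
  · simpa [h] using (key (i - j).toNat j).2

theorem supDegree_window_ne_zero
    (hE : ∀ i j, supDegree (conjField σ E i) (conjField σ E j) ≠ 0) {A : Subfield U} {i : ℤ}
    (hA : conjField σ E i ≤ A) (m n : ℤ) : supDegree A (window σ E m n) ≠ 0 := by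
  rcases lt_or_ge n m with h | h
  · have : window σ E m n ≤ A := by
      rw [window_le_iff]
      intro i h h'
      omega
    rw [supDegree_eq_one_iff.2 this]
    exact one_ne_zero
  · obtain ⟨k, rfl⟩ : ∃ k : ℕ, n = m + k := ⟨(n - m).toNat, by omega⟩
    clear h
    induction k with
    | zero =>
      simp only [Nat.cast_zero, add_zero, window_self]
      exact supDegree_ne_zero_mono hA le_rfl (hE i m)
    | succ k ih =>
      rw [← window_sup_window σ E (p := m + k + 1) (n := m + k) (by omega) (by omega)
        (by omega)]
      apply supDegree_sup_ne_zero ih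
      push_cast
      rw [add_assoc, window_self]
      exact supDegree_ne_zero_mono hA le_rfl (hE i _)

end Window

section Independence

variable [Field U] {σ : U ≃+* U} {E : Subfield U} {ℓ : ℕ}

theorem supDegree_window_of_step
    (h : ∀ n : ℕ, supDegree (window σ E 0 n) (conjField σ E (n + 1)) = ℓ) {m n : ℤ}
    (hmn : m ≤ n) : supDegree (window σ E m n) (conjField σ E (n + 1)) = ℓ := by
  obtain ⟨k, rfl⟩ : ∃ k : ℕ, n = m + k := ⟨(n - m).toNat, by omega⟩
  rw [← h k, ← supDegree_conjField σ (window σ E 0 k) _ m, conjField_window, conjField_conjField]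
  congr 2 <;> ring

theorem supDegree_window_window
    (h : ∀ n : ℕ, supDegree (window σ E 0 n) (conjField σ E (n + 1)) = ℓ) {m n : ℤ}
    (hmn : m ≤ n) (k : ℕ) : supDegree (window σ E m n) (window σ E n (n + k)) = ℓ ^ k := by
  induction k with
  | zero =>
    rw [pow_zero, supDegree_eq_one_iff]
    exact window_mono σ E hmn (by simp)
  | succ k ih =>
    have h1 := supDegree_mul (window σ E m n) (window σ E n (n + k))
      (window σ E (n + k + 1) (n + k + 1))
    rw [ih, window_sup_window σ E hmn (by omega) (by omega),
      window_sup_window σ E (by omega) (by omega) (by omega), window_self,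
      supDegree_window_of_step h (by omega), ← pow_succ] at h1
    rw [h1]
    push_cast
    ring_nf

theorem supDegree_sup_left_window
    (hE : ∀ i j, supDegree (conjField σ E i) (conjField σ E j) ≠ 0)
    (h : ∀ n : ℕ, supDegree (window σ E 0 n) (conjField σ E (n + 1)) = ℓ)
    {m n p : ℤ} (hmn : m ≤ n) (hnp : n ≤ p)
    {A B C : Subfield U} (hA : conjField σ E n ≤ A) (hA' : A ≤ window σ E n p)
    (hB : B ≤ window σ E n p) (hC : C ≤ window σ E m n) :
    supDegree (A ⊔ C) B = supDegree A B := by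
  obtain ⟨k, rfl⟩ : ∃ k : ℕ, p = n + k := ⟨(p - n).toNat, by omega⟩
  refine supDegree_sup_eq_of_disjoint (A := conjField σ E n) (B := window σ E n (n + k))
    (C := window σ E m n) (conjField_le_window σ E hmn le_rfl)
    (supDegree_window_ne_zero hE le_rfl _ _) ?_ hA hA' hB hC
  rw [supDegree_window_window h hmn, ← window_self, supDegree_window_window h le_rfl]

theorem supDegree_sup_right_window
    (hE : ∀ i j, supDegree (conjField σ E i) (conjField σ E j) ≠ 0)
    (h : ∀ n : ℕ, supDegree (window σ E 0 n) (conjField σ E (n + 1)) = ℓ)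
    {m n p : ℤ} (hmn : m ≤ n) (hnp : n ≤ p)
    {A B C : Subfield U} (hA : conjField σ E n ≤ A) (hA' : A ≤ window σ E m n)
    (hB : B ≤ window σ E m n) (hC : C ≤ window σ E n p) :
    supDegree (A ⊔ C) B = supDegree A B := by
  obtain ⟨k, rfl⟩ : ∃ k : ℕ, p = n + k := ⟨(p - n).toNat, by omega⟩
  refine supDegree_sup_eq_of_disjoint (A := conjField σ E n) (B := window σ E m n)
    (C := window σ E n (n + k)) (conjField_le_window σ E le_rfl hnp)
    (supDegree_window_ne_zero hE le_rfl _ _) ?_ hA hA' hB hC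
  refine supDegree_eq_of_disjoint_symm (conjField_le_window σ E le_rfl hnp)
    (conjField_le_window σ E hmn le_rfl) (supDegree_window_ne_zero hE le_rfl _ _) ?_
  rw [supDegree_window_window h hmn, ← window_self, supDegree_window_window h le_rfl]

/-- The degree of `E` over the compositum of two of its conjugates does not change when further
conjugates beyond these two are adjoined. -/
theorem supDegree_sup_outer_windows
    (hE : ∀ i j, supDegree (conjField σ E i) (conjField σ E j) ≠ 0)
    (h : ∀ n : ℕ, supDegree (window σ E 0 n) (conjField σ E (n + 1)) = ℓ)
    {N N' n n' : ℤ} (hN : 0 ≤ N) (hN' : N ≤ N') (hn : 0 ≤ n)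
    (hn' : n ≤ n') :
    supDegree (window σ E (-N') (-N) ⊔ window σ E n n') E =
      supDegree (conjField σ E (-N) ⊔ conjField σ E n) E := by
  have hE0 {a b : ℤ} (ha : a ≤ 0) (hb : 0 ≤ b) : E ≤ window σ E a b := by
    simpa only [conjField_zero] using conjField_le_window σ E ha hb
  have h1 : supDegree (conjField σ E (-N) ⊔ conjField σ E n ⊔ window σ E n n') E =
      supDegree (conjField σ E (-N) ⊔ conjField σ E n) E :=
    supDegree_sup_right_window hE h (m := -N) (n := n) (p := n') (by omega) (by omega)
      le_sup_right
      (sup_le (conjField_le_window σ E le_rfl (by omega))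
        (conjField_le_window σ E (by omega) le_rfl))
      (hE0 (by omega) (by omega)) le_rfl
  have h2 : supDegree (conjField σ E (-N) ⊔ window σ E n n' ⊔ window σ E (-N') (-N)) E =
      supDegree (conjField σ E (-N) ⊔ window σ E n n') E :=
    supDegree_sup_left_window hE h (m := -N') (n := -N) (p := n') (by omega) (by omega)
      le_sup_left
      (sup_le (conjField_le_window σ E le_rfl (by omega))
        (window_mono σ E (by omega) le_rfl))
      (hE0 (by omega) (by omega)) le_rfl
  rw [← h1, sup_assoc, sup_eq_right.mpr (conjField_le_window σ E le_rfl hn' :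
    conjField σ E n ≤ window σ E n n'), ← h2]
  congr 1
  rw [sup_right_comm, sup_eq_right.mpr (conjField_le_window σ E (by omega) le_rfl :
    conjField σ E (-N) ≤ window σ E (-N') (-N))]

theorem supDegree_conj_pair_mul
    (hE : ∀ i j, supDegree (conjField σ E i) (conjField σ E j) ≠ 0)
    (h : ∀ n : ℕ, supDegree (window σ E 0 n) (conjField σ E (n + 1)) = ℓ)
    (N n : ℕ) :
    supDegree (conjField σ E (-N) ⊔ conjField σ E n) E *
      (supDegree (E ⊔ conjField σ E N) (window σ E 0 N) *
        supDegree (E ⊔ conjField σ E n) (window σ E 0 n)) =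
      supDegree (E ⊔ conjField σ E ((N + n : ℕ) : ℤ)) (window σ E 0 ((N + n : ℕ) : ℤ)) := by
  have hE0 {a b : ℤ} (ha : a ≤ 0) (hb : 0 ≤ b) : E ≤ window σ E a b := by
    simpa only [conjField_zero] using conjField_le_window σ E ha hb
  have hEl : conjField σ E 0 ≤ E := (conjField_zero σ E).le
  have h1 : supDegree (E ⊔ conjField σ E N) (window σ E 0 N) =
      supDegree (conjField σ E (-N) ⊔ E ⊔ conjField σ E n) (window σ E (-N) 0) := by
    rw [supDegree_sup_right_window hE h (m := -N) (n := 0) (p := n) (by omega) (by omega)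
      (hEl.trans le_sup_right)
      (sup_le (conjField_le_window σ E le_rfl (by omega)) (hE0 (by omega) le_rfl)) le_rfl
      (conjField_le_window σ E (by omega) le_rfl),
      ← supDegree_conjField σ (E ⊔ conjField σ E N) _ (-N), conjField_sup, conjField_conjField,
      conjField_window]
    simp only [add_neg_cancel, conjField_zero, zero_add]
  have h2 : supDegree (E ⊔ conjField σ E n) (window σ E 0 n) =
      supDegree (E ⊔ conjField σ E n ⊔ window σ E (-N) 0) (window σ E 0 n) := by
    rw [supDegree_sup_left_window hE h (m := -N) (n := 0) (p := n) (by omega) (by omega)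
      (hEl.trans le_sup_left)
      (sup_le (hE0 le_rfl (by omega)) (conjField_le_window σ E (by omega) le_rfl)) le_rfl
      le_rfl]
  have h3 : supDegree (E ⊔ conjField σ E ((N + n : ℕ) : ℤ)) (window σ E 0 ((N + n : ℕ) : ℤ)) =
      supDegree (conjField σ E (-N) ⊔ conjField σ E n) (window σ E (-N) n) := by
    rw [← supDegree_conjField σ (E ⊔ conjField σ E _) _ (-N), conjField_sup,
      conjField_conjField, conjField_window]
    congr 3 <;> push_cast <;> ring
  rw [h1, h2, h3, ← window_sup_window σ E (m := -N) (n := 0) (p := 0) (q := n) (by omega)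
    (by omega) (by omega), sup_right_comm (conjField σ E (-N)) E]
  have h4 : E ⊔ conjField σ E n ⊔ window σ E (-N) 0 =
      conjField σ E (-N) ⊔ conjField σ E n ⊔ E ⊔ window σ E (-N) 0 := by
    have i1 : E ≤ window σ E (-N) 0 := hE0 (by omega) le_rfl
    have i2 : conjField σ E (-N) ≤ window σ E (-N) 0 :=
      conjField_le_window σ E le_rfl (by omega)
    apply le_antisymm
    · exact sup_le (sup_le (i1.trans le_sup_right)
        (le_sup_right.trans (le_sup_left.trans le_sup_left))) le_sup_right
    · exact sup_le (sup_le (sup_le (i2.trans le_sup_right) (le_sup_right.trans le_sup_left))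
        (i1.trans le_sup_right)) le_sup_right
  rw [h4, supDegree_mul, supDegree_mul]
  apply supDegree_congr
  have i1 : E ≤ window σ E (-N) 0 := hE0 (by omega) le_rfl
  rw [← sup_assoc E, sup_eq_right.mpr i1]

/-- The degree of `E` over the compositum of `σ^{-N}(E)` and `σ^n(E)` is eventually constant. -/
theorem exists_supDegree_conj_pair_eq
    (hE : ∀ i j, supDegree (conjField σ E i) (conjField σ E j) ≠ 0)
    (h : ∀ n : ℕ, supDegree (window σ E 0 n) (conjField σ E (n + 1)) = ℓ)
    :
    ∃ N₀ t : ℕ, t ≠ 0 ∧ ∀ N n : ℕ, N₀ ≤ N → N₀ ≤ n →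
      supDegree (conjField σ E (-N) ⊔ conjField σ E n) E = t := by
  set T : ℕ → ℕ → ℕ := fun N n => supDegree (conjField σ E (-N) ⊔ conjField σ E n) E with hT
  set c : ℕ → ℕ := fun N => supDegree (E ⊔ conjField σ E N) (window σ E 0 N) with hc
  have hTc (N n : ℕ) : T N n * (c N * c n) = c (N + n) := supDegree_conj_pair_mul hE h N n
  have hE' (i : ℤ) : supDegree (conjField σ E i) E ≠ 0 := by
    simpa only [conjField_zero] using hE i 0
  have hT0 (N n : ℕ) : T N n ≠ 0 :=
    (supDegree_anti_left le_sup_left (hE' (-N))).1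
  have hc0 (N : ℕ) : c N ≠ 0 := by
    refine supDegree_window_ne_zero hE (i := 0) ?_ _ _
    rw [conjField_zero]
    exact le_sup_left
  have hc1 : c 1 = 1 := by
    rw [hc]
    simp only [supDegree_eq_one_iff, window_le_iff]
    intro i h0 h1
    rcases (by push_cast at h1; omega : i = 0 ∨ i = 1) with rfl | rfl
    · rw [conjField_zero]
      exact le_sup_left
    · exact le_sup_right
  have hmono : Monotone fun N => T N 1 := by
    apply monotone_nat_of_le_succ
    intro N
    have h1 := supDegree_sup_outer_windows hE h (N := N) (N' := N + 1) (n := 1) (n' := 1)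
      (by omega) (by omega) (by omega) (by omega)
    have h2 := supDegree_anti_left (A := conjField σ E (-((N + 1 : ℕ) : ℤ)) ⊔ conjField σ E 1)
      (A' := window σ E (-((N : ℤ) + 1)) (-N) ⊔ window σ E 1 1) (B := E)
      (sup_le_sup (conjField_le_window σ E (by push_cast; omega) (by push_cast; omega))
        (window_self σ E 1).ge) (hT0 (N + 1) 1)
    rw [h1] at h2
    simpa [hT] using h2.2
  have hbdd (N : ℕ) : T N 1 ≤ supDegree (conjField σ E 1) E := by
    simpa [hT] using (supDegree_anti_left (le_sup_right : _ ≤ conjField σ E (-N) ⊔ _) (hE' 1)).2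
  obtain ⟨N₀, hN₀⟩ : ∃ N₀, ∀ N, N₀ ≤ N → T N 1 = T N₀ 1 := by
    have hfin : (Set.range fun N => T N 1).Finite :=
      (Set.finite_Iic _).subset (Set.range_subset_iff.2 hbdd)
    obtain ⟨_, ⟨N₀, rfl⟩, hmax⟩ := hfin.exists_maximal (Set.range_nonempty _)
    exact ⟨N₀, fun N hN => le_antisymm (hmax ⟨N, rfl⟩ (hmono hN)) (hmono hN)⟩
  have hck (k : ℕ) : c (N₀ + k) = c N₀ * T N₀ 1 ^ k := by
    induction k with
    | zero => simp
    | succ k ih =>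
      rw [← add_assoc, ← hTc, hN₀ _ (by omega), ih, hc1]
      ring
  have hpos : 0 < T N₀ 1 := Nat.pos_of_ne_zero (hT0 _ _)
  have hTeq (N n : ℕ) (hN : N₀ ≤ N) (hn : N₀ ≤ n) : T N n * c N₀ = T N₀ 1 ^ N₀ := by
    obtain ⟨a, rfl⟩ := Nat.exists_eq_add_of_le hN
    obtain ⟨b, rfl⟩ := Nat.exists_eq_add_of_le hn
    have h1 := hTc (N₀ + a) (N₀ + b)
    rw [hck, hck, show N₀ + a + (N₀ + b) = N₀ + (N₀ + a + b) by ring, hck] at h1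
    have h2 : 0 < c N₀ * T N₀ 1 ^ (a + b) :=
      Nat.mul_pos (Nat.pos_of_ne_zero (hc0 _)) (pow_pos hpos _)
    apply Nat.eq_of_mul_eq_mul_right h2
    rw [pow_add] at h2 ⊢
    rw [pow_add, pow_add] at h1
    linarith [h1]
  refine ⟨N₀, T N₀ N₀, hT0 _ _, fun N n hN hn => ?_⟩
  exact Nat.eq_of_mul_eq_mul_right (Nat.pos_of_ne_zero (hc0 N₀))
    ((hTeq N n hN hn).trans (hTeq N₀ N₀ le_rfl le_rfl).symm)

end Independence

section FieldOfDefinition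

variable [Field U]

theorem fAdj_le_iff {K F : Subfield U} {S : Set U} : fAdj K S ≤ F ↔ K ≤ F ∧ S ⊆ F := by
  constructor
  · intro h
    refine ⟨fun x hx => h ?_, fun x hx => h (IntermediateField.subset_adjoin K S hx)⟩
    exact (IntermediateField.adjoin K S).algebraMap_mem ⟨x, hx⟩
  · rintro ⟨hK, hS⟩
    have : IntermediateField.adjoin K S ≤ Subfield.extendScalars hK :=
      IntermediateField.adjoin_le_iff.2 hS
    exact this

theorem le_fAdj (K : Subfield U) (S : Set U) : K ≤ fAdj K S := (fAdj_le_iff.1 le_rfl).1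

theorem subset_fAdj (K : Subfield U) (S : Set U) : S ⊆ fAdj K S := (fAdj_le_iff.1 le_rfl).2

theorem sup_fAdj {K R : Subfield U} (hK : K ≤ R) (S : Set U) : R ⊔ fAdj K S = fAdj R S := by
  apply le_antisymm
  · exact sup_le (le_fAdj R S) (fAdj_le_iff.2 ⟨hK.trans (le_fAdj R S), subset_fAdj R S⟩)
  · exact fAdj_le_iff.2 ⟨le_sup_left, (subset_fAdj K S).trans (le_sup_right : fAdj K S ≤ _)⟩

theorem deg_eq_relfinrank (R : Subfield U) (S : Set U) : deg R S = R.relfinrank (fAdj R S) :=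
  (Subfield.relfinrank_eq_finrank_of_le (le_fAdj R S)).symm

theorem supDegree_fAdj {K R : Subfield U} (hK : K ≤ R) (S : Set U) :
    supDegree R (fAdj K S) = deg R S := by
  rw [supDegree, sup_fAdj hK, deg_eq_relfinrank]

/-- A finite family whose span contains `1` and is stable under multiplication by `S` spans
`R(S)` over `R`. -/
theorem adjoin_le_span {R : Subfield U} {S : Set U} {t : ℕ} {b : Fin t → U}
    (h1 : (1 : U) ∈ Submodule.span R (Set.range b))
    (hS : ∀ s ∈ S, ∀ i, s * b i ∈ Submodule.span R (Set.range b)) :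
    (deg R S ≠ 0 ∧ deg R S ≤ t) ∧
      ∀ x ∈ fAdj R S, x ∈ Submodule.span R (Set.range b) := by
  set V := Submodule.span R (Set.range b) with hV
  have hmul : ∀ s ∈ S, ∀ v ∈ V, s * v ∈ V := by
    intro s hs v hv
    induction hv using Submodule.span_induction with
    | mem x hx =>
      obtain ⟨i, rfl⟩ := hx
      exact hS s hs i
    | zero => simp
    | add x y _ _ hx hy =>
      rw [mul_add]
      exact V.add_mem hx hy
    | smul c x _ hx =>
      rw [mul_smul_comm]
      exact V.smul_mem c hx
  have hadj : ∀ x ∈ Algebra.adjoin R S, ∀ v ∈ V, x * v ∈ V := by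
    intro x hx
    induction hx using Algebra.adjoin_induction with
    | mem x hx => exact hmul x hx
    | algebraMap r =>
      intro v hv
      rw [← Algebra.smul_def]
      exact V.smul_mem r hv
    | add x y _ _ hx hy =>
      intro v hv
      rw [add_mul]
      exact V.add_mem (hx v hv) (hy v hv)
    | mul x y _ _ hx hy =>
      intro v hv
      rw [mul_assoc]
      exact hx _ (hy v hv)
  have hle : Subalgebra.toSubmodule (Algebra.adjoin R S) ≤ V := by
    intro x hx
    simpa using hadj x hx 1 h1
  have : FiniteDimensional R V := FiniteDimensional.span_of_finite R (Set.finite_range b)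
  have hfin : FiniteDimensional R (Algebra.adjoin R S) := Submodule.finiteDimensional_of_le hle
  have halg : Algebra.IsAlgebraic R (Algebra.adjoin R S) := inferInstance
  have hSalg : ∀ x ∈ S, IsAlgebraic R x := by
    intro x hx
    have h2 := halg.isAlgebraic ⟨x, Algebra.subset_adjoin hx⟩
    exact (isAlgebraic_algebraMap_iff (A := U) Subtype.val_injective).2 h2
  have heq : (IntermediateField.adjoin R S).toSubalgebra = Algebra.adjoin R S :=
    IntermediateField.adjoin_toSubalgebra_of_isAlgebraic hSalg
  have hdeg : deg R S = Module.finrank R (Algebra.adjoin R S) := by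
    rw [← heq]
    rfl
  refine ⟨⟨?_, ?_⟩, ?_⟩
  · rw [hdeg]
    exact Module.finrank_pos.ne'
  · rw [hdeg]
    refine (Submodule.finrank_mono hle).trans ?_
    exact (finrank_range_le_card (R := R) b).trans (by simp)
  · intro x hx
    apply hle
    change x ∈ Algebra.adjoin R S
    rw [← heq]
    exact hx

theorem exists_basis_of_deg_ne_zero {R : Subfield U} {S : Set U} (h : deg R S ≠ 0) :
    ∃ b : Fin (deg R S) → U, (∀ i, b i ∈ Submonoid.closure S) ∧ LinearIndependent R b ∧
      ∀ x ∈ fAdj R S, x ∈ Submodule.span R (Set.range b) := by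
  have hfin : FiniteDimensional R (IntermediateField.adjoin R S) :=
    Module.finite_of_finrank_pos (Nat.pos_of_ne_zero h)
  have hSalg : ∀ x ∈ S, IsAlgebraic R x := by
    intro x hx
    have h2 := Algebra.IsAlgebraic.isAlgebraic (R := R)
      (⟨x, IntermediateField.subset_adjoin R S hx⟩ : IntermediateField.adjoin R S)
    exact (isAlgebraic_algebraMap_iff (A := U) Subtype.val_injective).2 h2
  have heq : (IntermediateField.adjoin R S).toSubalgebra = Algebra.adjoin R S :=
    IntermediateField.adjoin_toSubalgebra_of_isAlgebraic hSalg
  obtain ⟨b, hbS, hspan, hli⟩ := exists_linearIndependent R (Submonoid.closure S : Set U)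
  have hspan' : Submodule.span R b = Subalgebra.toSubmodule (Algebra.adjoin R S) := by
    rw [hspan, Algebra.adjoin_eq_span]
  have hfin' : FiniteDimensional R (Submodule.span R b) := by
    rw [hspan', ← heq]
    exact hfin
  have hr : Set.range ((↑) : b → U) = b := Subtype.range_coe
  have hfin'' : FiniteDimensional R (Submodule.span R (Set.range ((↑) : b → U))) := by
    rw [hr]
    exact hfin'
  have hbfin : Finite b := Module.Finite.finite_basis (Module.Basis.span hli)
  have : Fintype b := Fintype.ofFinite b
  have hcard : Fintype.card b = deg R S := by
    rw [← finrank_span_eq_card hli, hr, hspan', ← heq]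
    rfl
  let e : Fin (deg R S) ≃ b := (finCongr hcard.symm).trans (Fintype.equivFin b).symm
  refine ⟨fun i => e i, fun i => hbS (e i).2, hli.comp e e.injective, fun x hx => ?_⟩
  have : Set.range (fun i => (e i : U)) = b := by
    exact (e.surjective.range_comp ((↑) : b → U)).trans hr
  rw [this, hspan', ← heq]
  exact hx

/-- A common field of definition: if `S` has the same degree over every member of a family of
fields, each of which has a common extension with `R₀` over which the degree is still the same,
then `S` has at most that degree over `K(S')` for a finite subset `S'` of the intersection
of the family. -/
theorem exists_finite_deg_le {K R₀ : Subfield U} {S : Set U} (hS : S.Finite) {t : ℕ} (ht : t ≠ 0)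
    (h₀ : deg R₀ S = t) (𝓡 : Set (Subfield U)) (h𝓡 : ∀ R ∈ 𝓡, deg R S = t)
    (h𝓡' : ∀ R ∈ 𝓡, ∃ R', R₀ ≤ R' ∧ R ≤ R' ∧ deg R' S = t) :
    ∃ S' : Set U, S'.Finite ∧ (∀ R ∈ 𝓡, S' ⊆ R) ∧
      deg (fAdj K S') S ≠ 0 ∧ deg (fAdj K S') S ≤ t := by
  obtain ⟨b, hbS, hspan⟩ : ∃ b : Fin t → U, (∀ i, b i ∈ Submonoid.closure S) ∧
      ∀ x ∈ fAdj R₀ S, x ∈ Submodule.span R₀ (Set.range b) := by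
    subst h₀
    obtain ⟨b, hbS, -, hspan⟩ := exists_basis_of_deg_ne_zero ht
    exact ⟨b, hbS, hspan⟩
  have hbF (R : Subfield U) (i : Fin t) : b i ∈ fAdj R S := by
    have : Submonoid.closure S ≤ (fAdj R S).toSubmonoid :=
      Submonoid.closure_le.2 (subset_fAdj R S)
    exact this (hbS i)
  have hc (x : U) (hx : x ∈ fAdj R₀ S) : ∃ c : Fin t → R₀, ∑ i, c i • b i = x :=
    (Submodule.mem_span_range_iff_exists_fun R₀).1 (hspan x hx)
  choose! c hc using hc
  set P : Set U := insert 1 (⋃ i, (fun s => s * b i) '' S) with hP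
  have hPfin : P.Finite := (Set.finite_iUnion fun i => hS.image _).insert 1
  have hPF (R : Subfield U) : P ⊆ fAdj R S := by
    rintro x (rfl | hx)
    · exact one_mem _
    · obtain ⟨i, s, hs, rfl⟩ := Set.mem_iUnion.1 hx
      exact mul_mem (subset_fAdj R S hs) (hbF R i)
  set S' : Set U := ⋃ i, (fun x => (c x i : U)) '' P with hS'
  have hspan_of (R : Subfield U) (hR : S' ⊆ R) (x : U) (hx : x ∈ P) :
      x ∈ Submodule.span R (Set.range b) := by
    rw [← hc x (hPF R₀ hx)]
    refine Submodule.sum_mem _ fun i _ => ?_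
    exact Submodule.smul_mem _ (⟨c x i, hR (Set.mem_iUnion.2 ⟨i, x, hx, rfl⟩)⟩ : R)
      (Submodule.subset_span ⟨i, rfl⟩)
  have hadj (R : Subfield U) (hR : S' ⊆ R) := adjoin_le_span (R := R) (S := S) (b := b)
    (hspan_of R hR 1 (Set.mem_insert _ _))
    (fun s hs i => hspan_of R hR _ (Set.mem_insert_of_mem _ (Set.mem_iUnion.2 ⟨i, s, hs, rfl⟩)))
  refine ⟨S', Set.finite_iUnion fun i => hPfin.image _, fun R hR => ?_,
    (hadj _ (subset_fAdj K S')).1⟩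
  obtain ⟨R', h₀', hRR', hdeg⟩ := h𝓡' R hR
  have hS'R₀ : S' ⊆ R₀ := by
    refine Set.iUnion_subset fun i => ?_
    rintro _ ⟨x, -, rfl⟩
    exact (c x i).2
  have hli' : LinearIndependent R' b := by
    have hsub := (hadj R' (hS'R₀.trans h₀')).2
    rw [linearIndependent_iff_card_le_finrank_span, Fintype.card_fin]
    have hle : Subalgebra.toSubmodule (IntermediateField.adjoin R' S).toSubalgebra ≤
        Submodule.span R' (Set.range b) := hsub
    have : FiniteDimensional R' (Submodule.span R' (Set.range b)) :=
      FiniteDimensional.span_of_finite R' (Set.finite_range b)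
    calc t = Module.finrank R' (IntermediateField.adjoin R' S) := hdeg.symm
      _ ≤ _ := Submodule.finrank_mono hle
  have hli : LinearIndependent R b := by
    rw [Fintype.linearIndependent_iff] at hli' ⊢
    intro g hg i
    have h0 := hli' (fun i => ⟨g i, hRR' (g i).2⟩) hg i
    exact Subtype.ext (Subtype.ext_iff.1 h0 : (g i : U) = 0)
  have hspanR : Subalgebra.toSubmodule (IntermediateField.adjoin R S).toSubalgebra ≤
      Submodule.span R (Set.range b) := by
    have hle : Submodule.span R (Set.range b) ≤
        Subalgebra.toSubmodule (IntermediateField.adjoin R S).toSubalgebra := by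
      rw [Submodule.span_le]
      rintro _ ⟨i, rfl⟩
      exact hbF R i
    have hfr : Module.finrank R (Subalgebra.toSubmodule
        (IntermediateField.adjoin R S).toSubalgebra) = t := h𝓡 R hR
    have : FiniteDimensional R (Subalgebra.toSubmodule
        (IntermediateField.adjoin R S).toSubalgebra) :=
      Module.finite_of_finrank_pos (by omega)
    refine (Submodule.eq_of_le_of_finrank_eq hle ?_).ge
    rw [hfr, finrank_span_eq_card hli, Fintype.card_fin]
  refine Set.iUnion_subset fun i => ?_
  rintro _ ⟨x, hx, rfl⟩
  obtain ⟨g, hg⟩ := (Submodule.mem_span_range_iff_exists_fun R).1 (hspanR (hPF R hx))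
  rw [Fintype.linearIndependent_iff] at hli'
  have h2 := hli' (fun i => ⟨g i, hRR' (g i).2⟩ - ⟨c x i, h₀' (c x i).2⟩) (by
    simp only [sub_smul, Finset.sum_sub_distrib, sub_eq_zero]
    exact hg.trans (hc x (hPF R₀ hx)).symm) i
  have h3 : (g i : U) = c x i := by
    simpa [Subtype.ext_iff, sub_eq_zero] using h2
  change (c x i : U) ∈ R
  rw [← h3]
  exact (g i).2

end FieldOfDefinition

section Tidy

variable [Field U] {σ : U ≃+* U} {K : Subfield U}

theorem conjField_eq_self (hK : K.map σ.toRingHom = K) (i : ℤ) : conjField σ K i = K := by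
  have h1 : conjField σ K 1 = K := by rw [conjField, zpow_one, hK]
  have step (i : ℤ) : conjField σ K (1 + i) = conjField σ K i := by
    rw [← conjField_conjField, h1]
  induction i with
  | zero => exact conjField_zero σ K
  | succ i ih => rw [add_comm, step, ih]
  | pred i ih => rw [← step, add_sub_cancel, ih]

theorem conjField_fAdj (hK : ∀ i, conjField σ K i = K) (S : Set U) (i : ℤ) :
    conjField σ (fAdj K S) i = fAdj K (⇑(σ ^ i) '' S) := by
  apply le_antisymm
  · rw [conjField, Subfield.map_le_iff_le_comap, fAdj_le_iff]
    refine ⟨?_, fun x hx => subset_fAdj K _ ⟨x, hx, rfl⟩⟩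
    rw [← Subfield.map_le_iff_le_comap]
    exact (hK i).le.trans (le_fAdj K _)
  · rw [fAdj_le_iff]
    refine ⟨(hK i).ge.trans (conjField_mono σ (le_fAdj K S) i), ?_⟩
    rintro _ ⟨x, hx, rfl⟩
    exact ⟨x, subset_fAdj K S hx, rfl⟩

/-- If `E'` is contained in all composita of distant conjugates of `E`, and `[E : E']` is bounded
by the common degree `t` of `E` over such composita, then `E'` is contained in all composita of
its own distant conjugates. -/
theorem le_sup_conjField_of_supDegree_le {E E' : Subfield U} {N₀ t : ℕ}
    (hE : ∀ i j, supDegree (conjField σ E i) (conjField σ E j) ≠ 0)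
    (ht : ∀ N N' n n' : ℤ, N₀ ≤ N → N ≤ N' → N₀ ≤ n → n ≤ n' →
      supDegree (window σ E (-N') (-N) ⊔ window σ E n n') E = t)
    (hE' : ∀ N n : ℤ, N₀ ≤ N → N₀ ≤ n → E' ≤ conjField σ E (-N) ⊔ conjField σ E n)
    (h0 : supDegree E' E ≠ 0) (hle : supDegree E' E ≤ t) {N n : ℤ} (hN : N₀ ≤ N) (hn : N₀ ≤ n) :
    E' ≤ conjField σ E' (-N) ⊔ conjField σ E' n := by
  have t0 : 0 < t := by omega
  have hs' (i p q : ℤ) (hp : p + N₀ ≤ i) (hq : i + N₀ ≤ q) :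
      conjField σ E' i ≤ conjField σ E p ⊔ conjField σ E q := by
    have := conjField_mono σ (hE' (i - p) (q - i) (by omega) (by omega)) i
    rwa [conjField_sup, conjField_conjField, conjField_conjField,
      show -(i - p) + i = p by ring, show q - i + i = q by ring] at this
  have hne (i j : ℤ) : supDegree (conjField σ E' i) (conjField σ E j) ≠ 0 := by
    refine supDegree_ne_zero_trans ?_ (hE i j)
    rwa [supDegree_conjField]
  have hdeg {Z : Subfield U} (i j p p' q q' : ℤ) (hZ : conjField σ E' j ≤ Z) (hpp' : p ≤ p')
      (hp : p' + N₀ ≤ i) (hq : i + N₀ ≤ q) (hqq' : q ≤ q')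
      (hZ' : Z ≤ window σ E p p' ⊔ window σ E q q') :
      t ≤ supDegree Z (conjField σ E i) := by
    rw [← ht (i - p') (i - p) (q - i) (q' - i) (by omega) (by omega) (by omega) (by omega),
      ← supDegree_conjField σ _ E i, conjField_sup, conjField_window, conjField_window,
      show -(i - p) + i = p by ring, show -(i - p') + i = p' by ring,
      show q - i + i = q by ring, show q' - i + i = q' by ring]
    exact (supDegree_anti_left hZ' (supDegree_anti_left hZ (hne j i)).1).2
  set W := conjField σ E' (-N) ⊔ conjField σ E' n
  set x := conjField σ E (-N)
  set y := conjField σ E n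
  have hxle : supDegree W x ≤ t :=
    (supDegree_anti_left le_sup_left (hne (-N) (-N))).2.trans (by rwa [supDegree_conjField])
  have hyle : supDegree (W ⊔ x) y ≤ t :=
    (supDegree_anti_left (le_sup_right.trans le_sup_left) (hne n n)).2.trans
      (by rwa [supDegree_conjField])
  have hE'0 : conjField σ E' 0 = E' := conjField_zero σ E'
  have hEx : E' ≤ x ⊔ y := hE' N n hN hn
  have hZ : W ⊔ E' ≤ conjField σ E (-N - N₀) ⊔ conjField σ E (n + N₀) := by
    refine sup_le (sup_le ?_ ?_) ?_
    · exact hs' _ _ _ (by omega) (by omega)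
    · exact hs' _ _ _ (by omega) (by omega)
    · rw [← hE'0]
      exact hs' _ _ _ (by omega) (by omega)
  have hyge : t ≤ supDegree (W ⊔ E') y := by
    refine hdeg n n (-N - N₀) (-N - N₀) (n + N₀) (n + N₀) (le_sup_right.trans le_sup_left)
      le_rfl (by omega) (by omega) le_rfl ?_
    rwa [window_self, window_self]
  have hxge : t ≤ supDegree (W ⊔ E' ⊔ y) x := by
    refine hdeg (-N) n (-N - N₀) (-N - N₀) n (n + N₀)
      ((le_sup_right.trans le_sup_left).trans le_sup_left) le_rfl (by omega) (by omega)
      (by omega) (sup_le (hZ.trans (sup_le_sup ?_ ?_)) (le_sup_of_le_right ?_))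
    · rw [window_self]
    · exact conjField_le_window σ E (by omega) le_rfl
    · exact conjField_le_window σ E le_rfl (by omega)
  have hcongr : supDegree W (E' ⊔ (y ⊔ x)) = supDegree W (x ⊔ y) := by
    rw [sup_comm y x, sup_eq_right.2 hEx]
  have e : supDegree W E' * (supDegree (W ⊔ E') y * supDegree (W ⊔ E' ⊔ y) x) =
      supDegree W x * supDegree (W ⊔ x) y := by
    rw [supDegree_mul, supDegree_mul, hcongr, supDegree_mul]
  have hne1 : supDegree W E' ≠ 0 := by
    refine supDegree_ne_zero_mono le_rfl hEx (supDegree_sup_ne_zero ?_ ?_)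
    · exact (supDegree_anti_left le_sup_left (hne (-N) (-N))).1
    · exact (supDegree_anti_left le_sup_left (hne (-N) n)).1
  have hle1 : supDegree W E' * (t * t) ≤ 1 * (t * t) := by
    calc _ ≤ supDegree W E' * (supDegree (W ⊔ E') y * supDegree (W ⊔ E' ⊔ y) x) := by gcongr
      _ = supDegree W x * supDegree (W ⊔ x) y := e
      _ ≤ 1 * (t * t) := by
        rw [one_mul]
        gcongr
  have := Nat.le_of_mul_le_mul_right hle1 (by positivity)
  exact supDegree_eq_one_iff.1 (by omega)

/-- A field of finite type over `K` with constant step degree is commensurable with one that is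
contained in all composita of its own distant conjugates. -/
theorem exists_commensurable_le_sup_conjField (hK : ∀ i, conjField σ K i = K) {S : Set U}
    (hS : S.Finite) {ℓ : ℕ}
    (hE : ∀ i j, supDegree (conjField σ (fAdj K S) i) (conjField σ (fAdj K S) j) ≠ 0)
    (h : ∀ n : ℕ, supDegree (window σ (fAdj K S) 0 n) (conjField σ (fAdj K S) (n + 1)) = ℓ) :
    ∃ S' : Set U, S'.Finite ∧ supDegree (fAdj K S') (fAdj K S) ≠ 0 ∧
      supDegree (fAdj K S) (fAdj K S') ≠ 0 ∧ ∃ N₀ : ℕ, ∀ N n : ℤ, N₀ ≤ N → N₀ ≤ n →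
        fAdj K S' ≤ conjField σ (fAdj K S') (-N) ⊔ conjField σ (fAdj K S') n := by
  obtain ⟨N₀, t, ht0, ht⟩ := exists_supDegree_conj_pair_eq hE h
  set E := fAdj K S with hES
  have ht' (N N' n n' : ℤ) (hN : N₀ ≤ N) (hN' : N ≤ N') (hn : N₀ ≤ n) (hn' : n ≤ n') :
      supDegree (window σ E (-N') (-N) ⊔ window σ E n n') E = t := by
    rw [supDegree_sup_outer_windows hE h (by omega) hN' (by omega) hn']
    lift N to ℕ using by omega
    lift n to ℕ using by omega
    exact ht N n (by omega) (by omega)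
  have hKE (i : ℤ) : K ≤ conjField σ E i := (hK i).ge.trans (conjField_mono σ (le_fAdj K S) i)
  have hdeg {R : Subfield U} {i : ℤ} (hR : conjField σ E i ≤ R) : deg R S = supDegree R E :=
    (supDegree_fAdj ((hKE i).trans hR) S).symm
  obtain ⟨S', hS', hS'R, hne, hle⟩ := exists_finite_deg_le (K := K)
    (R₀ := conjField σ E (-N₀) ⊔ conjField σ E N₀) hS ht0
    ((hdeg le_sup_left).trans (ht N₀ N₀ le_rfl le_rfl))
    {R | ∃ N n : ℤ, N₀ ≤ N ∧ N₀ ≤ n ∧ R = conjField σ E (-N) ⊔ conjField σ E n}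
    (by
      rintro _ ⟨N, n, hN, hn, rfl⟩
      rw [hdeg le_sup_left, ← ht' N N n n hN le_rfl hn le_rfl, window_self, window_self])
    (by
      rintro _ ⟨N, n, hN, hn, rfl⟩
      refine ⟨window σ E (-N) (-N₀) ⊔ window σ E N₀ n, sup_le_sup ?_ ?_, sup_le_sup ?_ ?_, ?_⟩
      · exact conjField_le_window σ E (by omega) le_rfl
      · exact conjField_le_window σ E le_rfl hn
      · exact conjField_le_window σ E le_rfl (by omega)
      · exact conjField_le_window σ E hn le_rfl
      · rw [hdeg (i := n) (le_sup_of_le_right (conjField_le_window σ E hn le_rfl)),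
          ht' N₀ N N₀ n le_rfl hN le_rfl hn])
  rw [← supDegree_fAdj (le_fAdj K S'), ← hES] at hne hle
  have hE' (N n : ℤ) (hN : N₀ ≤ N) (hn : N₀ ≤ n) :
      fAdj K S' ≤ conjField σ E (-N) ⊔ conjField σ E n :=
    fAdj_le_iff.2 ⟨(hKE (-N)).trans le_sup_left, hS'R _ ⟨N, n, hN, hn, rfl⟩⟩
  refine ⟨S', hS', hne, ?_, N₀, fun N n hN hn =>
    le_sup_conjField_of_supDegree_le hE ht' hE' hne hle hN hn⟩
  have hE0 (i : ℤ) : supDegree E (conjField σ E i) ≠ 0 := by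
    simpa only [conjField_zero] using hE 0 i
  exact supDegree_ne_zero_mono le_rfl (hE' N₀ N₀ le_rfl le_rfl)
    (supDegree_sup_ne_zero (hE0 _) (hE0 _))

end Tidy

section Commensurable

variable [Field U] {K A B : Subfield U}

theorem isAlgebraic_of_mem {x : U} (hx : x ∈ A) : IsAlgebraic A x :=
  isAlgebraic_algebraMap (A := U) (⟨x, hx⟩ : A)

theorem isAlgebraic_of_supDegree_ne_zero (h : supDegree A B ≠ 0) {x : U} (hx : x ∈ B) :
    IsAlgebraic A x := by
  rw [supDegree, Subfield.relfinrank_eq_finrank_of_le le_sup_left] at h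
  have : FiniteDimensional A (Subfield.extendScalars (le_sup_left : A ≤ A ⊔ B)) :=
    Module.finite_of_finrank_pos (Nat.pos_of_ne_zero h)
  have h2 := Algebra.IsAlgebraic.isAlgebraic (R := A)
    (⟨x, (le_sup_right : B ≤ A ⊔ B) hx⟩ : Subfield.extendScalars (le_sup_left : A ≤ A ⊔ B))
  exact (isAlgebraic_algebraMap_iff (A := U) Subtype.val_injective).2 h2

theorem supDegree_fAdj_ne_zero (hK : K ≤ A) {S : Set U} (hS : S.Finite)
    (h : ∀ x ∈ S, IsAlgebraic A x) : supDegree A (fAdj K S) ≠ 0 := by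
  rw [supDegree_fAdj hK]
  have : Finite S := hS
  have : FiniteDimensional A (IntermediateField.adjoin A S) :=
    IntermediateField.finiteDimensional_adjoin fun x hx => (h x hx).isIntegral
  exact Module.finrank_pos.ne'

theorem isAlgebraic_of_isAlgebraic_of_supDegree_ne_zero (h : supDegree A B ≠ 0) {x : U}
    (hx : IsAlgebraic B x) : IsAlgebraic A x := by
  refine isAlgebraic_of_supDegree_ne_zero (B := fAdj B {x}) (supDegree_ne_zero_trans h ?_)
    (subset_fAdj B {x} rfl)
  exact supDegree_fAdj_ne_zero le_rfl (Set.finite_singleton x) (by simpa using hx)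

theorem isAlgebraic_iff_of_supDegree_ne_zero (hAB : supDegree A B ≠ 0) (hBA : supDegree B A ≠ 0)
    (x : U) : IsAlgebraic A x ↔ IsAlgebraic B x :=
  ⟨isAlgebraic_of_isAlgebraic_of_supDegree_ne_zero hBA,
    isAlgebraic_of_isAlgebraic_of_supDegree_ne_zero hAB⟩

theorem supDegree_ne_zero_of_isAlgebraic_iff {S T : Set U} (hT : T.Finite)
    (h : ∀ x : U, IsAlgebraic (fAdj K S) x ↔ IsAlgebraic (fAdj K T) x) :
    supDegree (fAdj K S) (fAdj K T) ≠ 0 :=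
  supDegree_fAdj_ne_zero (le_fAdj K S) hT fun x hx =>
    (h x).2 (isAlgebraic_of_mem (subset_fAdj K T hx))

theorem mem_matroid_closure_iff {S : Set U} {x : U} :
    x ∈ (AlgebraicIndependent.matroid K U).closure S ↔ IsAlgebraic (fAdj K S) x := by
  rw [AlgebraicIndependent.matroid_closure_eq]
  exact (IntermediateField.isAlgebraic_adjoin_iff).symm

theorem supDegree_conjField_fAdj_ne_zero {σ : U ≃+* U} (hK : ∀ i, conjField σ K i = K)
    {S : Set U} (hS : S.Finite) (h : ∀ x ∈ S, IsAlgebraic (fAdj K S) (σ x)) :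
    supDegree (fAdj K S) (conjField σ (fAdj K S) 1) ≠ 0 ∧
      supDegree (conjField σ (fAdj K S) 1) (fAdj K S) ≠ 0 := by
  have hKσ : K.map σ.toRingHom = K := by simpa [conjField] using hK 1
  have h1 : conjField σ (fAdj K S) 1 = fAdj K (σ '' S) := by
    rw [conjField_fAdj hK, zpow_one]
  rw [h1]
  constructor
  · refine supDegree_fAdj_ne_zero (le_fAdj K S) (hS.image σ) ?_
    rintro _ ⟨x, hx, rfl⟩
    exact h x hx
  refine supDegree_fAdj_ne_zero (le_fAdj K _) hS fun x hx => ?_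
  set M := AlgebraicIndependent.matroid K U
  obtain ⟨I, hI⟩ := M.exists_isBasis S
  have hIfin : I.Finite := hS.subset hI.subset
  have hJ : M.Indep (σ '' I) := by
    have hI' : AlgebraicIndependent K ((↑) : I → U) := hI.indep
    let f : K →+* K := σ.toRingHom.restrict K K fun x hx => hKσ.le ⟨x, hx, rfl⟩
    have hf : Function.Surjective f := by
      rintro ⟨y, hy⟩
      obtain ⟨x, hx, rfl⟩ := hKσ.ge hy
      exact ⟨⟨x, hx⟩, rfl⟩
    have := hI'.ringHom_of_comp_eq f σ hf σ.injective rfl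
    exact this.to_subtype_range' (by rw [Set.range_comp, Subtype.range_coe])
  have hJcl : σ '' I ⊆ M.closure S := by
    rintro _ ⟨y, hy, rfl⟩
    exact mem_matroid_closure_iff.2 (h y (hI.subset hy))
  obtain ⟨J, hJb, hJJ⟩ := hJ.subset_isBasis_of_subset hJcl
  have hcard : J.encard = (σ '' I).encard := by
    rw [hJb.encard_eq_eRk, M.eRk_closure_eq, ← hI.encard_eq_eRk, σ.injective.encard_image]
  have hJeq : σ '' I = J := (hIfin.image σ).eq_of_subset_of_encard_le hJJ hcard.le
  rw [← mem_matroid_closure_iff]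
  have hx' : x ∈ M.closure (σ '' I) := by
    rw [hJeq, hJb.closure_eq_closure, M.closure_closure, mem_matroid_closure_iff]
    exact isAlgebraic_of_mem (subset_fAdj K S hx)
  exact M.closure_subset_closure (Set.image_mono hI.subset) hx'

end Commensurable

section Bridge

variable [Field U] {σ : U ≃+* U} {K : Subfield U}

theorem conjField_inv (σ : U ≃+* U) (E : Subfield U) (i : ℤ) :
    conjField σ⁻¹ E i = conjField σ E (-i) := by
  rw [conjField, conjField, inv_zpow']

theorem window_inv (σ : U ≃+* U) (E : Subfield U) (m n : ℤ) :
    window σ⁻¹ E m n = window σ E (-n) (-m) := by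
  apply le_antisymm
  · rw [window_le_iff]
    intro i h h'
    rw [conjField_inv]
    exact conjField_le_window σ E (by omega) (by omega)
  · rw [window_le_iff]
    intro i h h'
    rw [← neg_neg i, ← conjField_inv]
    exact conjField_le_window σ⁻¹ E (by omega) (by omega)

theorem Kinv_eq_self (hK : ∀ i, conjField σ K i = K) : Kinv σ K = K := by
  have (n : ℕ) : K.map (σ⁻¹ ^ n : U ≃+* U).toRingHom = K := by
    have h := hK (-n)
    rwa [← conjField_inv, conjField, zpow_natCast] at h
  simp only [Kinv, this, iSup_const]

theorem fAdj_iUnion_image (hK : ∀ i, conjField σ K i = K) (S : Set U) (k : ℕ) :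
    fAdj K (⋃ i ∈ Set.Iic k, ⇑(σ ^ i) '' S) = window σ (fAdj K S) 0 k := by
  apply le_antisymm
  · have h0 : K ≤ window σ (fAdj K S) 0 k :=
      (hK 0).ge.trans ((conjField_mono σ (le_fAdj K S) 0).trans
        (conjField_le_window σ _ le_rfl (by omega)))
    refine fAdj_le_iff.2 ⟨h0, Set.iUnion₂_subset fun i hi => ?_⟩
    have h1 := conjField_le_window σ (fAdj K S) (i := i) (m := 0) (n := k) (by omega)
      (by exact_mod_cast hi)
    rw [conjField_fAdj hK, zpow_natCast] at h1
    exact (subset_fAdj K _).trans h1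
  · rw [window_le_iff]
    intro i h h'
    lift i to ℕ using h
    rw [conjField_fAdj hK, zpow_natCast]
    refine fAdj_le_iff.2 ⟨le_fAdj K _, Set.Subset.trans ?_ (subset_fAdj K _)⟩
    exact Set.subset_biUnion_of_mem (u := fun i : ℕ => ⇑(σ ^ i) '' S) (by exact_mod_cast h')

theorem ldSeq_eq_supDegree (hK : ∀ i, conjField σ K i = K) (S : Set U) (k : ℕ) :
    ldSeq σ K S k = supDegree (window σ (fAdj K S) 0 k) (conjField σ (fAdj K S) (k + 1)) := by
  rw [ldSeq, ← supDegree_fAdj (le_fAdj K _), fAdj_iUnion_image hK, conjField_fAdj hK]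
  norm_cast

theorem ddSeq_eq_supDegree (hK : ∀ i, conjField σ K i = K) (S : Set U) (k : ℕ) :
    ddSeq σ K S k = supDegree (fAdj K S) (conjField σ (fAdj K S) k) := by
  rw [ddSeq, ← supDegree_fAdj (le_fAdj K _), conjField_fAdj hK, zpow_natCast]

end Bridge

section Growth

variable [Field U] {σ : U ≃+* U} {A B E : Subfield U}

theorem supDegree_conjField_ne_zero_of_commensurable
    (hA : ∀ i j, supDegree (conjField σ A i) (conjField σ A j) ≠ 0)
    (hAB : supDegree A B ≠ 0) (hBA : supDegree B A ≠ 0) (i j : ℤ) :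
    supDegree (conjField σ B i) (conjField σ B j) ≠ 0 := by
  rw [← supDegree_conjField σ B A i] at hBA
  rw [← supDegree_conjField σ A B j] at hAB
  exact supDegree_ne_zero_trans hBA (supDegree_ne_zero_trans (hA i j) hAB)

theorem antitone_supDegree_window
    (hE : ∀ i j, supDegree (conjField σ E i) (conjField σ E j) ≠ 0) :
    Antitone fun k : ℕ => supDegree (window σ E 0 k) (conjField σ E (k + 1)) := by
  refine antitone_nat_of_succ_le fun k => ?_
  rw [← supDegree_conjField σ (window σ E 0 k) _ 1, conjField_window, conjField_conjField]
  push_cast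
  refine (supDegree_anti_left (window_mono σ E (by omega) le_rfl) ?_).2
  exact (supDegree_anti_left (conjField_le_window σ E (i := k + 1) (by omega) le_rfl)
    (hE _ _)).1

theorem supDegree_window_succ (E : Subfield U) (k : ℕ) :
    supDegree E (window σ E 0 (k + 1 : ℕ)) =
      supDegree E (window σ E 0 k) * supDegree (window σ E 0 k) (conjField σ E (k + 1)) := by
  have h0 : E ≤ window σ E 0 k := by
    simpa only [conjField_zero] using conjField_le_window σ E (le_refl 0) (by omega : (0 : ℤ) ≤ k)
  have h1 := supDegree_mul E (window σ E 0 k) (conjField σ E (k + 1))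
  rw [sup_eq_right.2 h0] at h1
  rw [h1, ← window_self σ E (k + 1), window_sup_window σ E (by omega) le_rfl (by omega)]
  push_cast
  rfl

theorem pow_le_supDegree_window {L : ℕ}
    (h : ∀ k : ℕ, L ≤ supDegree (window σ E 0 k) (conjField σ E (k + 1))) (k : ℕ) :
    L ^ k ≤ supDegree E (window σ E 0 k) := by
  induction k with
  | zero =>
    rw [pow_zero, Nat.cast_zero, window_self, conjField_zero, supDegree_eq_one_iff.2 le_rfl]
  | succ k ih =>
    rw [supDegree_window_succ, pow_succ]
    exact Nat.mul_le_mul ih (h k)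

theorem exists_supDegree_window_le
    (hE : ∀ i j, supDegree (conjField σ E i) (conjField σ E j) ≠ 0) {L : ℕ}
    (h : ∀ᶠ k : ℕ in atTop, supDegree (window σ E 0 k) (conjField σ E (k + 1)) = L) :
    ∃ C : ℕ, ∀ k : ℕ, supDegree E (window σ E 0 k) ≤ C * L ^ k := by
  obtain ⟨k₀, hk₀⟩ := eventually_atTop.1 h
  have hv (k : ℕ) : supDegree E (window σ E 0 k) ≠ 0 :=
    supDegree_window_ne_zero hE (conjField_zero σ E).le 0 k
  have hL : 0 < L := by
    rw [← hk₀ k₀ le_rfl, Nat.pos_iff_ne_zero]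
    exact (supDegree_anti_left (conjField_le_window σ E (i := 0) le_rfl (by omega)) (hE _ _)).1
  refine ⟨supDegree E (window σ E 0 k₀), fun k => ?_⟩
  rcases le_total k k₀ with hk | hk
  · have : supDegree E (window σ E 0 k) ≤ supDegree E (window σ E 0 k₀) :=
      supDegree_le_of_le ((window_mono σ E le_rfl (by omega)).trans le_sup_right) (hv k₀)
    exact this.trans (Nat.le_mul_of_pos_right _ (pow_pos hL k))
  · induction k, hk using Nat.le_induction with
    | base => exact Nat.le_mul_of_pos_right _ (pow_pos hL _)
    | succ k hk ih =>
      rw [supDegree_window_succ, hk₀ k hk, pow_succ, ← mul_assoc]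
      exact Nat.mul_le_mul_right L ih

theorem exists_supDegree_conjField_le
    (hA : ∀ i j, supDegree (conjField σ A i) (conjField σ A j) ≠ 0)
    (hAB : supDegree A B ≠ 0) (hBA : supDegree B A ≠ 0) :
    ∃ C : ℕ, ∀ k : ℤ, supDegree B (conjField σ B k) ≤ C * supDegree A (conjField σ A k) := by
  refine ⟨supDegree B A * supDegree A B, fun k => ?_⟩
  have hAk : supDegree A (conjField σ A k) ≠ 0 := by simpa only [conjField_zero] using hA 0 k
  have hABk : supDegree (conjField σ A k) (conjField σ B k) ≠ 0 := by rwa [supDegree_conjField]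
  have e : supDegree B (A ⊔ (conjField σ A k ⊔ conjField σ B k)) =
      supDegree B A * (supDegree (B ⊔ A) (conjField σ A k) *
        supDegree (B ⊔ A ⊔ conjField σ A k) (conjField σ B k)) := by
    rw [supDegree_mul, supDegree_mul]
  have i1 := supDegree_anti_left (le_sup_right : A ≤ B ⊔ A) hAk
  have i2 := supDegree_anti_left (le_sup_right : _ ≤ B ⊔ A ⊔ conjField σ A k) hABk
  rw [supDegree_conjField σ A B k] at i2
  calc supDegree B (conjField σ B k)
      ≤ supDegree B (A ⊔ (conjField σ A k ⊔ conjField σ B k)) := by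
        refine supDegree_le_of_le ?_ ?_
        · exact le_sup_of_le_right (le_sup_of_le_right le_sup_right)
        · rw [e]
          exact mul_ne_zero hBA (mul_ne_zero i1.1 i2.1)
    _ ≤ supDegree B A * (supDegree A (conjField σ A k) * supDegree A B) := by
        rw [e]
        exact Nat.mul_le_mul_left _ (Nat.mul_le_mul i1.2 i2.2)
    _ = _ := by ring

/-- If `E` is contained in all composita of its distant conjugates, then up to a constant factor,
only the two outer conjugates contribute to the degree of a window. -/
theorem exists_supDegree_window_le_supDegree_conjField
    (hE : ∀ i j, supDegree (conjField σ E i) (conjField σ E j) ≠ 0) {N₀ : ℕ}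
    (h : ∀ N n : ℤ, N₀ ≤ N → N₀ ≤ n → E ≤ conjField σ E (-N) ⊔ conjField σ E n) :
    ∃ C : ℕ, ∀ k : ℕ, supDegree E (window σ E 0 k) ≤ C * supDegree E (conjField σ E k) := by
  refine ⟨supDegree E (window σ E 0 N₀) * supDegree E (window σ E (-N₀) 0), fun k => ?_⟩
  have hsub : window σ E 0 k ≤ E ⊔ (conjField σ E k ⊔
      (window σ E 0 N₀ ⊔ window σ E (-N₀ + k) (0 + k))) := by
    rw [window_le_iff]
    intro i hi hik
    by_cases h1 : i ≤ N₀
    · exact le_sup_of_le_right (le_sup_of_le_right (le_sup_of_le_left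
        (conjField_le_window σ E hi h1)))
    by_cases h2 : -N₀ + k ≤ i
    · exact le_sup_of_le_right (le_sup_of_le_right (le_sup_of_le_right
        (conjField_le_window σ E h2 (by omega))))
    have h3 := conjField_mono σ (h i (k - i) (by omega) (by omega)) i
    rw [conjField_sup, conjField_conjField, conjField_conjField, neg_add_cancel, sub_add_cancel,
      conjField_zero] at h3
    exact h3.trans (sup_le_sup_left le_sup_left _)
  have h1 : supDegree E (window σ E 0 N₀) ≠ 0 :=
    supDegree_window_ne_zero hE (conjField_zero σ E).le _ _
  have h2 : supDegree (conjField σ E k) (window σ E (-N₀ + k) (0 + k)) ≠ 0 :=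
    supDegree_window_ne_zero hE le_rfl _ _
  have h3 : supDegree E (conjField σ E k) ≠ 0 := by simpa only [conjField_zero] using hE 0 k
  have e : supDegree E (conjField σ E k ⊔ (window σ E 0 N₀ ⊔ window σ E (-N₀ + k) (0 + k))) =
      supDegree E (conjField σ E k) * (supDegree (E ⊔ conjField σ E k) (window σ E 0 N₀) *
        supDegree (E ⊔ conjField σ E k ⊔ window σ E 0 N₀) (window σ E (-N₀ + k) (0 + k))) := by
    rw [supDegree_mul, supDegree_mul]
  have i1 := supDegree_anti_left (le_sup_left : E ≤ E ⊔ conjField σ E k) h1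
  have i2 := supDegree_anti_left
    (le_sup_right.trans le_sup_left : _ ≤ E ⊔ conjField σ E k ⊔ window σ E 0 N₀) h2
  have e2 : supDegree (conjField σ E k) (window σ E (-N₀ + k) (0 + k)) =
      supDegree E (window σ E (-N₀) 0) := by
    rw [← conjField_window, supDegree_conjField]
  rw [e2] at i2
  calc supDegree E (window σ E 0 k)
      ≤ supDegree E (conjField σ E k ⊔
          (window σ E 0 N₀ ⊔ window σ E (-N₀ + k) (0 + k))) := by
        refine supDegree_le_of_le hsub ?_
        rw [e]
        exact mul_ne_zero h3 (mul_ne_zero i1.1 i2.1)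
    _ ≤ supDegree E (conjField σ E k) *
          (supDegree E (window σ E 0 N₀) * supDegree E (window σ E (-N₀) 0)) := by
        rw [e]
        exact Nat.mul_le_mul_left _ (Nat.mul_le_mul i1.2 i2.2)
    _ = _ := by ring

theorem tendsto_const_rpow_one_div {C : ℝ} (hC : 0 < C) :
    Tendsto (fun k : ℕ => C ^ (1 / (k : ℝ))) atTop (nhds 1) := by
  have h := tendsto_one_div_atTop_nhds_zero_nat (𝕜 := ℝ)
  simpa [Function.comp_def] using (Real.continuousAt_const_rpow (b := 0) hC.ne').tendsto.comp h

theorem le_of_pow_le_mul {v : ℕ → ℕ} {D : ℝ} {L C : ℕ}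
    (hD : Tendsto (fun k => (v k : ℝ) ^ (1 / (k : ℝ))) atTop (nhds D))
    (h : ∀ k, L ^ k ≤ C * v k) : (L : ℝ) ≤ D := by
  have hC : 0 < (C : ℝ) := by
    have := h 0
    rw [pow_zero] at this
    exact_mod_cast Nat.pos_of_mul_pos_right this
  have ht := (tendsto_const_rpow_one_div hC).mul hD
  rw [one_mul] at ht
  refine ge_of_tendsto ht ?_
  filter_upwards [eventually_ne_atTop 0] with k hk
  rw [← Real.mul_rpow (by positivity) (by positivity)]
  calc (L : ℝ) = ((L : ℝ) ^ k) ^ (1 / (k : ℝ)) := by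
        rw [one_div, Real.pow_rpow_inv_natCast (by positivity) hk]
    _ ≤ _ := by
        refine Real.rpow_le_rpow (by positivity) ?_ (by positivity)
        exact_mod_cast h k

theorem le_of_le_mul_pow {v : ℕ → ℕ} {D : ℝ} {L C : ℕ} (hv : v 0 ≠ 0)
    (hD : Tendsto (fun k => (v k : ℝ) ^ (1 / (k : ℝ))) atTop (nhds D))
    (h : ∀ k, v k ≤ C * L ^ k) : D ≤ L := by
  have hC : 0 < (C : ℝ) := by
    have := h 0
    rw [pow_zero, mul_one] at this
    exact_mod_cast (Nat.pos_of_ne_zero hv).trans_le this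
  have ht := (tendsto_const_rpow_one_div hC).mul_const (L : ℝ)
  rw [one_mul] at ht
  refine le_of_tendsto_of_tendsto hD ht ?_
  filter_upwards [eventually_ne_atTop 0] with k hk
  calc (v k : ℝ) ^ (1 / (k : ℝ)) ≤ ((C : ℝ) * (L : ℝ) ^ k) ^ (1 / (k : ℝ)) := by
        refine Real.rpow_le_rpow (by positivity) ?_ (by positivity)
        exact_mod_cast h k
    _ = (C : ℝ) ^ (1 / (k : ℝ)) * L := by
        rw [Real.mul_rpow (by positivity) (by positivity), one_div,
          Real.pow_rpow_inv_natCast (by positivity) hk]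

/-- The distant degree is at most the limit degree, for commensurable fields. -/
theorem distantDegree_le_limitDegree
    (hA : ∀ i j, supDegree (conjField σ A i) (conjField σ A j) ≠ 0)
    (hAB : supDegree A B ≠ 0) (hBA : supDegree B A ≠ 0) {L : ℕ} {D : ℝ}
    (hL : ∀ᶠ k : ℕ in atTop, supDegree (window σ B 0 k) (conjField σ B (k + 1)) = L)
    (hD : Tendsto (fun k : ℕ => (supDegree A (conjField σ A k) : ℝ) ^ (1 / (k : ℝ)))
      atTop (nhds D)) : D ≤ L := by
  have hB := supDegree_conjField_ne_zero_of_commensurable hA hAB hBA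
  obtain ⟨C₁, h₁⟩ := exists_supDegree_conjField_le hB hBA hAB
  obtain ⟨C₂, h₂⟩ := exists_supDegree_window_le hB hL
  refine le_of_le_mul_pow (C := C₁ * C₂) ?_ hD fun k => ?_
  · simpa [conjField_zero] using hA 0 0
  · have h₃ : supDegree B (conjField σ B k) ≤ supDegree B (window σ B 0 k) :=
      supDegree_le_of_le
        (le_sup_of_le_right (conjField_le_window σ B (by omega) le_rfl))
        (supDegree_window_ne_zero hB (conjField_zero σ B).le _ _)
    calc _ ≤ C₁ * supDegree B (conjField σ B k) := h₁ k
      _ ≤ C₁ * (C₂ * L ^ k) := Nat.mul_le_mul_left _ (h₃.trans (h₂ k))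
      _ = _ := (mul_assoc _ _ _).symm

/-- The limit degree is at most the distant degree for a field contained in all composita of
its distant conjugates. -/
theorem limitDegree_le_distantDegree
    (hA : ∀ i j, supDegree (conjField σ A i) (conjField σ A j) ≠ 0)
    (hAB : supDegree A B ≠ 0) (hBA : supDegree B A ≠ 0) {L : ℕ} {D : ℝ}
    (hL : ∀ k : ℕ, L ≤ supDegree (window σ B 0 k) (conjField σ B (k + 1)))
    (hD : Tendsto (fun k : ℕ => (supDegree A (conjField σ A k) : ℝ) ^ (1 / (k : ℝ)))
      atTop (nhds D)) {N₀ : ℕ}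
    (h : ∀ N n : ℤ, N₀ ≤ N → N₀ ≤ n → B ≤ conjField σ B (-N) ⊔ conjField σ B n) : L ≤ D := by
  have hB := supDegree_conjField_ne_zero_of_commensurable hA hAB hBA
  obtain ⟨C₁, h₁⟩ := exists_supDegree_conjField_le hA hAB hBA
  obtain ⟨C₂, h₂⟩ := exists_supDegree_window_le_supDegree_conjField hB h
  refine le_of_pow_le_mul (C := C₂ * C₁) hD fun k => ?_
  calc L ^ k ≤ supDegree B (window σ B 0 k) := pow_le_supDegree_window hL k
    _ ≤ C₂ * supDegree B (conjField σ B k) := h₂ k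
    _ ≤ C₂ * (C₁ * supDegree A (conjField σ A k)) := Nat.mul_le_mul_left _ (h₁ k)
    _ = _ := (mul_assoc _ _ _).symm

end Growth

section DegreeRatio

variable [Field U] {σ : U ≃+* U} {A B C : Subfield U}

/-- The ratio `[A ⊔ B : A] / [A ⊔ B : B]`, which is multiplicative on commensurable fields. -/
noncomputable def degreeRatio (A B : Subfield U) : ℝ := supDegree A B / supDegree B A

theorem degreeRatio_pos (hAB : supDegree A B ≠ 0) (hBA : supDegree B A ≠ 0) :
    0 < degreeRatio A B := by
  rw [degreeRatio]
  positivity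

theorem supDegree_eq_degreeRatio_mul (hBA : supDegree B A ≠ 0) :
    (supDegree A B : ℝ) = degreeRatio A B * supDegree B A := by
  rw [degreeRatio, div_mul_cancel₀]
  exact_mod_cast hBA

theorem degreeRatio_mul_swap (hAB : supDegree A B ≠ 0) (hBA : supDegree B A ≠ 0) :
    degreeRatio A B * degreeRatio B A = 1 := by
  rw [degreeRatio, degreeRatio]
  field_simp

theorem degreeRatio_conjField (A B : Subfield U) (i : ℤ) :
    degreeRatio (conjField σ A i) (conjField σ B i) = degreeRatio A B := by
  rw [degreeRatio, supDegree_conjField, supDegree_conjField, degreeRatio]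

theorem degreeRatio_mul (hAB : supDegree A B ≠ 0) (hBA : supDegree B A ≠ 0)
    (hBC : supDegree B C ≠ 0) (hCB : supDegree C B ≠ 0) :
    degreeRatio A B * degreeRatio B C = degreeRatio A C := by
  have hAC := supDegree_ne_zero_trans hAB hBC
  have hCA := supDegree_ne_zero_trans hCB hBA
  have e1 := supDegree_mul A B C
  have e2 := supDegree_mul A C B
  have e3 := supDegree_mul B A C
  have e4 := supDegree_mul B C A
  have e5 := supDegree_mul C A B
  have e6 := supDegree_mul C B A
  rw [sup_comm C B] at e2
  rw [sup_comm B A] at e3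
  rw [sup_comm C A] at e4
  rw [sup_comm C A] at e5
  rw [sup_comm C B, sup_comm B A] at e6
  have n1 := (supDegree_anti_left (le_sup_left : A ≤ A ⊔ B) hAC).1
  have n2 := (supDegree_anti_left (le_sup_left : A ≤ A ⊔ C) hAB).1
  have n3 := (supDegree_anti_left (le_sup_left : B ≤ B ⊔ C) hBA).1
  rw [degreeRatio, degreeRatio, degreeRatio, div_mul_div_comm,
    div_eq_div_iff (by positivity) (by positivity)]
  have f1 : supDegree A B * supDegree (A ⊔ B) C = supDegree A C * supDegree (A ⊔ C) B :=
    e1.trans e2.symm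
  have f2 : supDegree B A * supDegree (A ⊔ B) C = supDegree B C * supDegree (B ⊔ C) A :=
    e3.trans e4.symm
  have f3 : supDegree C A * supDegree (A ⊔ C) B = supDegree C B * supDegree (B ⊔ C) A :=
    e5.trans e6.symm
  have hx : supDegree (A ⊔ B) C * supDegree (A ⊔ C) B * supDegree (B ⊔ C) A ≠ 0 := by
    positivity
  have : supDegree A B * supDegree B C * supDegree C A =
      supDegree A C * (supDegree B A * supDegree C B) := by
    apply Nat.eq_of_mul_eq_mul_left (Nat.pos_of_ne_zero hx)
    calc _ = (supDegree A B * supDegree (A ⊔ B) C) * (supDegree B C * supDegree (B ⊔ C) A) *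
          (supDegree C A * supDegree (A ⊔ C) B) := by ring
      _ = _ := by
        rw [f1, ← f2, f3]
        ring
  exact_mod_cast this

theorem degreeRatio_conjField_natCast
    (hA : ∀ i j, supDegree (conjField σ A i) (conjField σ A j) ≠ 0) (k : ℕ) :
    degreeRatio A (conjField σ A k) = degreeRatio A (conjField σ A 1) ^ k := by
  have hA0 (i : ℤ) : supDegree A (conjField σ A i) ≠ 0 := by
    simpa only [conjField_zero] using hA 0 i
  have hA0' (i : ℤ) : supDegree (conjField σ A i) A ≠ 0 := by
    simpa only [conjField_zero] using hA i 0
  induction k with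
  | zero =>
    rw [Nat.cast_zero, conjField_zero, pow_zero, degreeRatio, supDegree_eq_one_iff.2 le_rfl]
    norm_num
  | succ k ih =>
    rw [← degreeRatio_mul (hA0 k) (hA0' k) (hA _ _) (hA _ _), ih, pow_succ, Nat.cast_succ,
      add_comm (k : ℤ) 1, ← conjField_conjField, degreeRatio_conjField]

theorem degreeRatio_conjField_eq_of_commensurable
    (hA : ∀ i j, supDegree (conjField σ A i) (conjField σ A j) ≠ 0)
    (hAB : supDegree A B ≠ 0) (hBA : supDegree B A ≠ 0) (i : ℤ) :
    degreeRatio B (conjField σ B i) = degreeRatio A (conjField σ A i) := by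
  have hA1 : supDegree A (conjField σ A i) ≠ 0 := by simpa only [conjField_zero] using hA 0 i
  have hA1' : supDegree (conjField σ A i) A ≠ 0 := by simpa only [conjField_zero] using hA i 0
  have hAB1 : supDegree (conjField σ A i) (conjField σ B i) ≠ 0 := by rwa [supDegree_conjField]
  have hBA1 : supDegree (conjField σ B i) (conjField σ A i) ≠ 0 := by rwa [supDegree_conjField]
  rw [← degreeRatio_mul hBA hAB (supDegree_ne_zero_trans hA1 hAB1)
      (supDegree_ne_zero_trans hBA1 hA1'), ← degreeRatio_mul hA1 hA1' hAB1 hBA1,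
    degreeRatio_conjField, mul_left_comm, degreeRatio_mul_swap hBA hAB, mul_one]

/-- Distant and inverse distant degree differ by the factor `degreeRatio A (σ(A))`. -/
theorem distantDegree_eq_degreeRatio_mul
    (hA : ∀ i j, supDegree (conjField σ A i) (conjField σ A j) ≠ 0) {D D' : ℝ}
    (hD : Tendsto (fun k : ℕ => (supDegree A (conjField σ A k) : ℝ) ^ (1 / (k : ℝ)))
      atTop (nhds D))
    (hD' : Tendsto (fun k : ℕ => (supDegree A (conjField σ A (-k)) : ℝ) ^ (1 / (k : ℝ)))
      atTop (nhds D')) :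
    D = degreeRatio A (conjField σ A 1) * D' := by
  have hpos : 0 < degreeRatio A (conjField σ A 1) :=
    degreeRatio_pos (by simpa only [conjField_zero] using hA 0 1)
      (by simpa only [conjField_zero] using hA 1 0)
  refine tendsto_nhds_unique hD ((hD'.const_mul _).congr' ?_)
  filter_upwards [eventually_ne_atTop 0] with k hk
  have hk0 : supDegree (conjField σ A k) A ≠ 0 := by simpa only [conjField_zero] using hA k 0
  have hshift : supDegree A (conjField σ A (-k)) = supDegree (conjField σ A k) A := by
    rw [← supDegree_conjField σ A _ k, conjField_conjField, neg_add_cancel, conjField_zero]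
  rw [supDegree_eq_degreeRatio_mul hk0, degreeRatio_conjField_natCast hA,
    Real.mul_rpow (by positivity) (by positivity), one_div,
    Real.pow_rpow_inv_natCast hpos.le hk, hshift]

/-- Limit and inverse limit degree differ by the factor `degreeRatio A (σ(A))`, for any field `A`
commensurable with the given one. -/
theorem limitDegree_eq_degreeRatio_mul
    (hA : ∀ i j, supDegree (conjField σ A i) (conjField σ A j) ≠ 0)
    (hAB : supDegree A B ≠ 0) (hBA : supDegree B A ≠ 0) {L L' : ℕ}
    (hL : ∀ᶠ k : ℕ in atTop, supDegree (window σ B 0 k) (conjField σ B (k + 1)) = L)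
    (hL' : ∀ᶠ k : ℕ in atTop, supDegree (window σ B (-k) 0) (conjField σ B (-(k + 1))) = L') :
    (L : ℝ) = degreeRatio A (conjField σ A 1) * L' := by
  have hB := supDegree_conjField_ne_zero_of_commensurable hA hAB hBA
  obtain ⟨k, hk, hk'⟩ := (hL.and hL').exists
  set W := window σ B 0 k with hW
  have hBW : B ≤ W := by
    simpa only [conjField_zero] using conjField_le_window σ B (le_refl 0) (by omega : (0 : ℤ) ≤ k)
  have hBW0 : supDegree B W ≠ 0 := supDegree_window_ne_zero hB (conjField_zero σ B).le _ _
  have hWB0 : supDegree W B ≠ 0 := by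
    rw [supDegree_eq_one_iff.2 hBW]
    exact one_ne_zero
  have hAW := supDegree_ne_zero_trans hAB hBW0
  have hWA := supDegree_ne_zero_trans hWB0 hBA
  have hWW := supDegree_conjField_ne_zero_of_commensurable hA hAW hWA
  have h1 : supDegree W (conjField σ W 1) = L := by
    rw [← hk]
    apply supDegree_congr
    rw [hW, conjField_window, ← window_self σ B (k + 1),
      window_sup_window σ B (by omega) (by omega) (by omega),
      window_sup_window σ B (by omega) (by omega) (by omega)]
  have h2 : supDegree (conjField σ W 1) W = L' := by
    rw [← hk', ← supDegree_conjField σ (window σ B (-k) 0) _ (k + 1),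
      conjField_window σ B (-k) 0 (k + 1), conjField_conjField, neg_add_cancel,
      show -(k : ℤ) + (k + 1) = 0 + 1 by ring,
      show (0 : ℤ) + (k + 1) = k + 1 by ring, hW, conjField_window]
    apply supDegree_congr
    rw [sup_comm, sup_comm _ (conjField σ B 0), ← window_self σ B 0,
      window_sup_window σ B (by omega) (by omega) (by omega),
      window_sup_window σ B (by omega) (by omega) (by omega)]
  rw [← degreeRatio_conjField_eq_of_commensurable hA hAW hWA, ← h1, ← h2]
  exact supDegree_eq_degreeRatio_mul (by simpa only [conjField_zero] using hWW 1 0)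

end DegreeRatio

section Main

variable [Field U] {σ : U ≃+* U} {K : Subfield U} {S : Set U}

theorem exists_eventually_supDegree_window_eq {E : Subfield U}
    (hE : ∀ i j, supDegree (conjField σ E i) (conjField σ E j) ≠ 0) :
    ∃ k₀ L : ℕ, ∀ k : ℕ, k₀ ≤ k → supDegree (window σ E 0 k) (conjField σ E (k + 1)) = L := by
  set f : ℕ → ℕ := fun k => supDegree (window σ E 0 k) (conjField σ E (k + 1))
  exact ⟨Function.argmin f, f (Function.argmin f), fun k hk =>
    le_antisymm (antitone_supDegree_window hE hk) (Function.argmin_le f k)⟩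

/-- Among the fields commensurable with `K(S)` there is one contained in all composita of its
distant conjugates. -/
theorem exists_le_sup_conjField (hK : ∀ i, conjField σ K i = K) (hS : S.Finite)
    (hA : ∀ i j, supDegree (conjField σ (fAdj K S) i) (conjField σ (fAdj K S) j) ≠ 0) :
    ∃ S' : Set U, S'.Finite ∧ supDegree (fAdj K S) (fAdj K S') ≠ 0 ∧
      supDegree (fAdj K S') (fAdj K S) ≠ 0 ∧ ∃ N₀ : ℕ, ∀ N n : ℤ, N₀ ≤ N → N₀ ≤ n →
        fAdj K S' ≤ conjField σ (fAdj K S') (-N) ⊔ conjField σ (fAdj K S') n := by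
  obtain ⟨k₀, L, hL⟩ := exists_eventually_supDegree_window_eq hA
  set A := fAdj K S
  set T : Set U := ⋃ i ∈ Set.Iic k₀, ⇑(σ ^ i) '' S
  have hT : T.Finite := (Set.finite_Iic k₀).biUnion fun i _ => hS.image _
  have hTE : fAdj K T = window σ A 0 k₀ := fAdj_iUnion_image hK S k₀
  have hAT : supDegree A (fAdj K T) ≠ 0 := by
    rw [hTE]
    exact supDegree_window_ne_zero hA (conjField_zero σ A).le _ _
  have hTA : supDegree (fAdj K T) A ≠ 0 := by
    have : A ≤ fAdj K T := by
      rw [hTE]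
      simpa only [conjField_zero] using
        conjField_le_window σ A (le_refl 0) (by omega : (0 : ℤ) ≤ k₀)
    rw [supDegree_eq_one_iff.2 this]
    exact one_ne_zero
  obtain ⟨S', hS', h1, h2, h3⟩ := exists_commensurable_le_sup_conjField hK hT
    (supDegree_conjField_ne_zero_of_commensurable hA hAT hTA) (ℓ := L) fun n => by
      rw [hTE, window_window σ A _ _ _ _ (by omega) (by omega), conjField_window,
        ← hL (k₀ + n) (by omega)]
      push_cast
      apply supDegree_congr
      rw [← window_self σ A (k₀ + n + 1),
        window_sup_window σ A (by omega) (by omega) (by omega),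
        window_sup_window σ A (by omega) (by omega) (by omega), add_assoc]
  exact ⟨S', hS', supDegree_ne_zero_trans hAT h2, supDegree_ne_zero_trans h1 hTA, h3⟩

end Main

/-- for `d` equi-algebraic with `a` over `K`, the conditions
(i) `ld(d/K) = dd(a/K)` and (ii) `ld(d/K) ≤ ld(e/K)` for all tuples `e` with
`K(e)^alg = K(a)^alg` are equivalent, and they are equivalent to the analogous
condition for `σ⁻¹`, i.e. `ild(d/K) = idd(a/K)`. -/
theorem stmt8 [Field U] [IsAlgClosed U] (σ : U ≃+* U) (K : Subfield U)
    (hK : K.map σ.toRingHom = K) {n r : ℕ} (a : Fin n → U) (d : Fin r → U)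
    (ha : ∀ i, IsAlgebraic (fAdj K (Set.range a)) (σ (a i)))
    (hd : ∀ i, IsAlgebraic (fAdj K (Set.range d)) (σ (d i)))
    (heq : ∀ x : U, IsAlgebraic (fAdj K (Set.range a)) x ↔
      IsAlgebraic (fAdj K (Set.range d)) x)
    (Ld : ℕ) (hLd : ∀ᶠ k in atTop, ldSeq σ K (Set.range d) k = Ld)
    (Da : ℝ)
    (hDa : Tendsto (fun k => (ddSeq σ K (Set.range a) k : ℝ) ^ (1 / (k : ℝ))) atTop (nhds Da))
    (Ild : ℕ) (hIld : ∀ᶠ k in atTop, ldSeq σ⁻¹ (Kinv σ K) (Set.range d) k = Ild)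
    (Ida : ℝ)
    (hIda : Tendsto (fun k => (ddSeq σ⁻¹ (Kinv σ K) (Set.range a) k : ℝ) ^ (1 / (k : ℝ)))
      atTop (nhds Ida)) :
    (((Ld : ℝ) = Da) ↔
      (∀ (q : ℕ) (e : Fin q → U) (Le : ℕ),
        (∀ x : U, IsAlgebraic (fAdj K (Set.range a)) x ↔
          IsAlgebraic (fAdj K (Set.range e)) x) →
        (∀ᶠ k in atTop, ldSeq σ K (Set.range e) k = Le) → Ld ≤ Le)) ∧
    (((Ld : ℝ) = Da) ↔ ((Ild : ℝ) = Ida)) := by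
  have hKi := conjField_eq_self hK
  set A := fAdj K (Set.range a) with hAdef
  set B := fAdj K (Set.range d) with hBdef
  have hA : ∀ i j, supDegree (conjField σ A i) (conjField σ A j) ≠ 0 := by
    obtain ⟨h1, h2⟩ := supDegree_conjField_fAdj_ne_zero hKi (Set.finite_range a)
      (by rintro _ ⟨i, rfl⟩; exact ha i)
    exact supDegree_conjField_ne_zero h1 h2
  have hAB : supDegree A B ≠ 0 := supDegree_ne_zero_of_isAlgebraic_iff (Set.finite_range d) heq
  have hBA : supDegree B A ≠ 0 :=
    supDegree_ne_zero_of_isAlgebraic_iff (Set.finite_range a) fun x => (heq x).symm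
  have hinv (i : ℤ) : conjField σ⁻¹ K i = K := by rw [conjField_inv, hKi]
  simp only [ldSeq_eq_supDegree hKi, ← hBdef] at hLd
  simp only [ddSeq_eq_supDegree hKi, ← hAdef] at hDa
  simp only [Kinv_eq_self hKi, ldSeq_eq_supDegree hinv, window_inv, conjField_inv, neg_zero,
    ← hBdef] at hIld
  simp only [Kinv_eq_self hKi, ddSeq_eq_supDegree hinv, conjField_inv, ← hAdef] at hIda
  refine ⟨⟨fun h q e Le he hLe => ?_, fun h => ?_⟩, ?_⟩
  · simp only [ldSeq_eq_supDegree hKi] at hLe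
    have := distantDegree_le_limitDegree hA
      (supDegree_ne_zero_of_isAlgebraic_iff (Set.finite_range e) he)
      (supDegree_ne_zero_of_isAlgebraic_iff (Set.finite_range a) fun x => (he x).symm) hLe hDa
    rw [← h] at this
    exact_mod_cast this
  · obtain ⟨S', hS', h1, h2, N₀, hN₀⟩ := exists_le_sup_conjField hKi (Set.finite_range a) hA
    obtain ⟨q, e, -, rfl⟩ := hS'.fin_param
    have hE := supDegree_conjField_ne_zero_of_commensurable hA h1 h2
    obtain ⟨k₀, Le, hLe⟩ := exists_eventually_supDegree_window_eq hE
    have hle : Ld ≤ Le := by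
      refine h q e Le (isAlgebraic_iff_of_supDegree_ne_zero h1 h2) ?_
      simp only [ldSeq_eq_supDegree hKi]
      exact eventually_atTop.2 ⟨k₀, hLe⟩
    have hle' : (Le : ℝ) ≤ Da := by
      refine limitDegree_le_distantDegree hA h1 h2 (fun k => ?_) hDa hN₀
      rw [← hLe (max k k₀) (le_max_right _ _)]
      exact antitone_supDegree_window hE (le_max_left k k₀)
    refine le_antisymm (le_trans ?_ hle') (distantDegree_le_limitDegree hA hAB hBA hLd hDa)
    exact_mod_cast hle
  · rw [limitDegree_eq_degreeRatio_mul hA hAB hBA hLd hIld,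
      distantDegree_eq_degreeRatio_mul hA hDa hIda]
    have hpos : 0 < degreeRatio A (conjField σ A 1) :=
      degreeRatio_pos (by simpa only [conjField_zero] using hA 0 1)
        (by simpa only [conjField_zero] using hA 1 0)
    exact mul_right_inj' hpos.ne'
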